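/- arXiv:math/0012092 — 2 statements merged into one kernel-verified Lean document; each statement's English description precedes it below -/
import Mathlib

section
/- Let R₁ = ℂ[X₁,…,Xₙ], R₂ = ℂ[T] localized at (T), and R = R₁ ⊗ R₂. Let M be a torsion-free R-module such that M/TM is a free R/TR-module of rank r and M[T⁻¹] is a free R₁ ⊗ ℂ(T)-module of rank r. Then M is a free R-module of rank r. -/
open TensorProduct
open scoped Pointwise

instance : (Ideal.span {(Polynomial.X : Polynomial ℂ)}).IsPrime :=
  (Ideal.span_singleton_prime Polynomial.X_ne_zero).mpr Polynomial.prime_X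

/-- `R₂ = ℂ[T]_{(T)}`, the localization of `ℂ[T]` at the prime ideal `(T)`. -/
def Rtwo : Type :=
  Localization (Ideal.span {(Polynomial.X : Polynomial ℂ)}).primeCompl

noncomputable instance : CommRing Rtwo := by unfold Rtwo; infer_instance
noncomputable instance : Algebra ℂ Rtwo := by unfold Rtwo; infer_instance
noncomputable instance : Algebra (Polynomial ℂ) Rtwo := by unfold Rtwo; infer_instance

/-- `R = R₁ ⊗_ℂ R₂` with `R₁ = ℂ[X₁,…,Xₙ]`, with its natural ring structure. -/
def RR (n : ℕ) : Type := MvPolynomial (Fin n) ℂ ⊗[ℂ] Rtwo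

noncomputable instance (n : ℕ) : CommRing (RR n) := by unfold RR; infer_instance

/-- The element `T = 1 ⊗ T` of `R`. -/
noncomputable def tt (n : ℕ) : RR n :=
  show MvPolynomial (Fin n) ℂ ⊗[ℂ] Rtwo from
    (1 : MvPolynomial (Fin n) ℂ) ⊗ₜ[ℂ] (algebraMap (Polynomial ℂ) Rtwo Polynomial.X)

section ProjectiveFreeness

open Polynomial

/-- The multiplicative set of monic polynomials. -/
def monicSubmonoid (A : Type*) [CommRing A] : Submonoid A[X] where
  carrier := {f | f.Monic}
  mul_mem' := fun ha hb => Polynomial.Monic.mul ha hb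
  one_mem' := Polynomial.monic_one

theorem mem_monicSubmonoid {A : Type*} [CommRing A] {f : A[X]} :
    f ∈ monicSubmonoid A ↔ f.Monic := Iff.rfl

theorem monicSubmonoid_le_nonZeroDivisors (A : Type*) [CommRing A] :
    monicSubmonoid A ≤ nonZeroDivisors A[X] :=
  fun _ hf => (mem_monicSubmonoid.mp hf).mem_nonZeroDivisors

/-- The localization `A⟨X⟩` of `A[X]` at the monic polynomials. -/
abbrev MonicLoc (A : Type*) [CommRing A] : Type _ := Localization (monicSubmonoid A)

theorem isPrincipal_of_C_mem {B : Type*} [CommRing B] [IsDomain B] [IsPrincipalIdealRing B]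
    {p : Ideal B[X]} (hm : ∀ f ∈ p, ¬ f.Monic) {π : B} (hπ : Prime π) (hp : C π ∈ p) :
    p = Ideal.span {C π} := by
  refine le_antisymm ?_ ((Ideal.span_singleton_le_iff_mem _).mpr hp)
  suffices H : ∀ (k : ℕ) (h : B[X]), h.natDegree < k → h ∈ p → C π ∣ h from
    fun h hh => Ideal.mem_span_singleton.mpr (H _ h (Nat.lt_succ_self _) hh)
  intro k
  induction k with
  | zero => intro h hk; omega
  | succ k ih =>
    intro h hk hh
    by_cases hd : π ∣ h.leadingCoeff
    · have hd' : C π ∣ C h.leadingCoeff * X ^ h.natDegree :=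
        (map_dvd C hd).mul_right _
      have hmem : h.eraseLead ∈ p := by
        rw [← self_sub_C_mul_X_pow]
        exact p.sub_mem hh (Ideal.mem_of_dvd p hd' hp)
      rw [← eraseLead_add_C_mul_X_pow h]
      refine dvd_add ?_ hd'
      by_cases h0 : h.natDegree = 0
      · rw [eq_C_of_natDegree_eq_zero h0, eraseLead_C]
        exact dvd_zero _
      · refine ih _ ?_ hmem
        have := eraseLead_natDegree_lt_or_eraseLead_eq_zero h
        rcases this with h1 | h1
        · omega
        · rw [h1, natDegree_zero]; omega
    · exfalso
      obtain ⟨x, y, hxy⟩ := (hπ.irreducible.coprime_iff_not_dvd (n := h.leadingCoeff)).mpr hd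
      refine hm (C y * h + C x * X ^ h.natDegree * C π)
        (p.add_mem (p.mul_mem_left _ hh) (p.mul_mem_left _ hp)) ?_
      have e : C y * h + C x * X ^ h.natDegree * C π = C y * h + C (x * π) * X ^ h.natDegree := by
        rw [C_mul]; ring
      rw [e]
      refine monic_of_natDegree_le_of_coeff_eq_one h.natDegree ?_ ?_
      · refine (natDegree_add_le _ _).trans (max_le ?_ ?_)
        · exact natDegree_C_mul_le _ _
        · exact natDegree_C_mul_X_pow_le _ _
      · simp only [coeff_add, coeff_C_mul, coeff_X_pow, if_true, mul_one, coeff_natDegree]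
        rw [← hxy]; ring

theorem isPrincipal_of_disjoint_monic {B : Type*} [CommRing B] [IsDomain B]
    [IsPrincipalIdealRing B] (p : Ideal B[X]) [hpp : p.IsPrime] (hm : ∀ f ∈ p, ¬ f.Monic) :
    p.IsPrincipal := by
  by_cases hbot : p = ⊥
  · rw [hbot]; infer_instance
  by_cases hc : p.comap C = ⊥
  · obtain ⟨q, hq, hqp⟩ := Ideal.IsPrime.exists_mem_prime_of_ne_bot hpp hbot
    have hdeg : q.natDegree ≠ 0 := by
      intro h0
      have h1 : q.coeff 0 ∈ p.comap C := by
        rw [Ideal.mem_comap, ← eq_C_of_natDegree_eq_zero h0]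
        exact hq
      rw [hc, Ideal.mem_bot] at h1
      apply hqp.ne_zero
      rw [eq_C_of_natDegree_eq_zero h0, h1, C_0]
    have hprim := hqp.irreducible.isPrimitive hdeg
    let K := FractionRing B
    let _ : Algebra B[X] K[X] := Polynomial.algebra B K
    have : IsLocalization ((nonZeroDivisors B).map C) K[X] :=
      Polynomial.isLocalization (nonZeroDivisors B) K
    have hprime : (p.map (algebraMap B[X] K[X])).IsPrime := by
      refine IsLocalization.isPrime_of_isPrime_disjoint ((nonZeroDivisors B).map C) K[X] p hpp ?_
      rw [Set.disjoint_left]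
      rintro _ ⟨c, hc0, rfl⟩ hcp
      have : c ∈ p.comap C := hcp
      rw [hc, Ideal.mem_bot] at this
      exact nonZeroDivisors.ne_zero hc0 this
    have hirr : Irreducible (q.map (algebraMap B K)) :=
      (hprim.irreducible_iff_irreducible_map_fraction_map).mp hqp.irreducible
    have hmax : Ideal.span {q.map (algebraMap B K)} = p.map (algebraMap B[X] K[X]) :=
      (PrincipalIdealRing.isMaximal_of_irreducible hirr).eq_of_le hprime.ne_top
        ((Ideal.span_singleton_le_iff_mem _).mpr (Ideal.mem_map_of_mem _ hq))
    refine ⟨q, le_antisymm (fun h hh => ?_) ((Ideal.span_singleton_le_iff_mem _).mpr hq)⟩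
    rw [Ideal.submodule_span_eq, Ideal.mem_span_singleton,
      hprim.dvd_iff_fraction_map_dvd_fraction_map K, ← Ideal.mem_span_singleton, hmax]
    exact Ideal.mem_map_of_mem (algebraMap B[X] K[X]) hh
  · obtain ⟨π, h1, h2⟩ := Ideal.IsPrime.exists_mem_prime_of_ne_bot
      (Ideal.comap_isPrime C p) hc
    rw [isPrincipal_of_C_mem hm h2 h1]
    infer_instance

theorem isPrincipalIdealRing_monicLoc (B : Type*) [CommRing B] [IsDomain B]
    [IsPrincipalIdealRing B] : IsPrincipalIdealRing (MonicLoc B) := by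
  refine IsPrincipalIdealRing.of_prime fun P hP => ?_
  have hP' : (P.comap (algebraMap B[X] (MonicLoc B))).IsPrime := Ideal.comap_isPrime _ P
  have : (P.comap (algebraMap B[X] (MonicLoc B))).IsPrincipal := by
    refine isPrincipal_of_disjoint_monic _ fun f hf hfm => ?_
    exact hP.ne_top (Ideal.eq_top_of_isUnit_mem _ hf
      (IsLocalization.map_units (MonicLoc B) (⟨f, hfm⟩ : monicSubmonoid B)))
  obtain ⟨g, hg⟩ := this.principal
  rw [← IsLocalization.map_under (monicSubmonoid B) (MonicLoc B) P, Ideal.under, hg,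
    Ideal.submodule_span_eq, Ideal.map_span, Set.image_singleton]
  exact ⟨⟨_, rfl⟩⟩

instance (B : Type*) [CommRing B] [IsDomain B] : IsDomain (MonicLoc B) :=
  IsLocalization.isDomain_localization (monicSubmonoid_le_nonZeroDivisors B)

/-- An idempotent matrix whose image is a free module. -/
def IsFreeIdem {R : Type*} [CommRing R] {N : ℕ} (e : Matrix (Fin N) (Fin N) R) : Prop :=
  ∃ (r : ℕ) (u : Matrix (Fin N) (Fin r) R) (v : Matrix (Fin r) (Fin N) R), u * v = e ∧ v * u = 1

/-- Every finitely generated projective `R`-module is free, phrased with idempotent matrices. -/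
def IdemFree (R : Type*) [CommRing R] : Prop :=
  ∀ (N : ℕ) (e : Matrix (Fin N) (Fin N) R), e * e = e → IsFreeIdem e

theorem IsFreeIdem.map {R S : Type*} [CommRing R] [CommRing S] {N : ℕ}
    {e : Matrix (Fin N) (Fin N) R} (h : IsFreeIdem e) (φ : R →+* S) : IsFreeIdem (e.map φ) := by
  obtain ⟨r, u, v, h1, h2⟩ := h
  refine ⟨r, u.map φ, v.map φ, ?_, ?_⟩
  · rw [← Matrix.map_mul, h1]
  · rw [← Matrix.map_mul, h2, Matrix.map_one φ (map_zero φ) (map_one φ)]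

theorem IdemFree.of_ringEquiv {R S : Type*} [CommRing R] [CommRing S] (φ : R ≃+* S)
    (h : IdemFree S) : IdemFree R := by
  intro N e he
  have h1 := (h N (e.map (φ : R →+* S)) (by rw [← Matrix.map_mul, he])).map (φ.symm : S →+* R)
  rw [Matrix.map_map] at h1
  convert h1
  ext i j
  simp

theorem idemFree_of_isPrincipalIdealRing (R : Type*) [CommRing R] [IsDomain R]
    [IsPrincipalIdealRing R] : IdemFree R := by
  intro N e he
  let f := Matrix.toLin' e
  let E : LinearMap.range f ≃ₗ[R] (Fin (Module.finrank R (LinearMap.range f)) → R) :=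
    (Module.finBasis R (LinearMap.range f)).equivFun
  let a := (LinearMap.range f).subtype ∘ₗ E.symm.toLinearMap
  let b := E.toLinearMap ∘ₗ f.rangeRestrict
  have hf : f ∘ₗ f = f := by rw [← Matrix.toLin'_mul, he]
  refine ⟨_, LinearMap.toMatrix' a, LinearMap.toMatrix' b, ?_, ?_⟩
  · rw [← LinearMap.toMatrix'_comp]
    have : a ∘ₗ b = f := by
      refine LinearMap.ext fun x => ?_
      simp [a, b]
    rw [this, LinearMap.toMatrix'_toLin']
  · rw [← LinearMap.toMatrix'_comp, ← LinearMap.toMatrix'_id]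
    congr 1
    have key : ∀ z : LinearMap.range f, f.rangeRestrict z.1 = z := by
      rintro ⟨_, y, rfl⟩
      exact Subtype.ext (LinearMap.congr_fun hf y)
    refine LinearMap.ext fun x => ?_
    change E (f.rangeRestrict (E.symm x).1) = x
    rw [key, E.apply_symm_apply]

theorem IdemFree.exists_linearEquiv {R M : Type*} [CommRing R] [AddCommGroup M] [Module R M]
    (h : IdemFree R) {N : ℕ} (f : (Fin N → R) →ₗ[R] M) (s : M →ₗ[R] (Fin N → R))
    (hfs : f ∘ₗ s = LinearMap.id) : ∃ r : ℕ, Nonempty (M ≃ₗ[R] (Fin r → R)) := by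
  have hid : (s ∘ₗ f) ∘ₗ (s ∘ₗ f) = s ∘ₗ f := by
    rw [LinearMap.comp_assoc, ← LinearMap.comp_assoc f, hfs, LinearMap.id_comp]
  obtain ⟨r, u, v, h1, h2⟩ := h N (LinearMap.toMatrix' (s ∘ₗ f))
    (by rw [← LinearMap.toMatrix'_comp, hid])
  have h1' : u.toLin' ∘ₗ v.toLin' = s ∘ₗ f := by
    rw [← Matrix.toLin'_mul, h1, Matrix.toLin'_toMatrix']
  have h2' : v.toLin' ∘ₗ u.toLin' = LinearMap.id := by
    rw [← Matrix.toLin'_mul, h2, Matrix.toLin'_one]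
  refine ⟨r, ⟨LinearEquiv.ofLinearMap (v.toLin' ∘ₗ s) (f ∘ₗ u.toLin') ?_ ?_⟩⟩
  · calc (v.toLin' ∘ₗ s) ∘ₗ f ∘ₗ u.toLin' = v.toLin' ∘ₗ (s ∘ₗ f) ∘ₗ u.toLin' := rfl
      _ = (v.toLin' ∘ₗ u.toLin') ∘ₗ (v.toLin' ∘ₗ u.toLin') := by rw [← h1']; rfl
      _ = LinearMap.id := by rw [h2']; rfl
  · calc (f ∘ₗ u.toLin') ∘ₗ v.toLin' ∘ₗ s = f ∘ₗ (u.toLin' ∘ₗ v.toLin') ∘ₗ s := rfl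
      _ = (f ∘ₗ s) ∘ₗ (f ∘ₗ s) := by rw [h1']; rfl
      _ = LinearMap.id := by rw [hfs]; rfl

section Horrocks

open IsLocalRing

theorem MonicLoc.exists_mul_eq {A : Type*} [CommRing A] (x : MonicLoc A) :
    ∃ a f : A[X], f.Monic ∧ x * algebraMap A[X] (MonicLoc A) f = algebraMap A[X] (MonicLoc A) a := by
  obtain ⟨⟨a, f⟩, h⟩ := IsLocalization.surj (monicSubmonoid A) x
  exact ⟨a, f.1, f.2, h⟩

theorem MonicLoc.isUnit_algebraMap {A : Type*} [CommRing A] {f : A[X]} (hf : f.Monic) :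
    IsUnit (algebraMap A[X] (MonicLoc A) f) :=
  IsLocalization.map_units (MonicLoc A) (⟨f, hf⟩ : monicSubmonoid A)

theorem MonicLoc.algebraMap_injective (A : Type*) [CommRing A] :
    Function.Injective (algebraMap A[X] (MonicLoc A)) :=
  IsLocalization.injective (MonicLoc A) (monicSubmonoid_le_nonZeroDivisors A)

/-- A form of Nakayama's lemma over a local ring. -/
theorem eq_top_of_sup_maximalIdeal_smul_eq_top {A Y : Type*} [CommRing A] [IsLocalRing A]
    [AddCommGroup Y] [Module A Y] {G N : Submodule A Y} (hG : G.FG) (h1 : G ⊔ N = ⊤)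
    (h2 : N ⊔ maximalIdeal A • (⊤ : Submodule A Y) = ⊤) : N = ⊤ := by
  have h3 : G ≤ N := by
    have h4 : G ≤ N ⊔ maximalIdeal A • G := by
      refine le_top.trans (h2.ge.trans (sup_le le_sup_left ?_))
      rw [← h1, Submodule.smul_sup]
      exact sup_le le_sup_right (Submodule.smul_le_right.trans le_sup_left)
    exact Submodule.le_of_le_smul_of_le_jacobson_bot hG
      (IsLocalRing.jacobson_eq_maximalIdeal ⊥ bot_ne_top).ge h4
  rwa [sup_eq_right.mpr h3] at h1

theorem pi_mem_smul_top {A Y : Type*} [CommRing A] [AddCommGroup Y] [Module A Y] {n : ℕ} (I : Ideal A)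
    {y : Fin n → Y} (hy : ∀ i, y i ∈ I • (⊤ : Submodule A Y)) :
    y ∈ I • (⊤ : Submodule A (Fin n → Y)) := by
  rw [← Finset.univ_sum_single y]
  refine Submodule.sum_mem _ fun i _ => ?_
  have h1 : LinearMap.single A (fun _ => Y) i (y i) ∈
      (I • (⊤ : Submodule A Y)).map (LinearMap.single A (fun _ => Y) i) :=
    Submodule.mem_map_of_mem (hy i)
  rw [Submodule.map_smul''] at h1
  exact Submodule.smul_mono le_rfl le_top h1

section Proper

variable (A : Type*) [CommRing A] [IsDomain A]

/-- The fractions with monic denominator that are regular at infinity. -/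
def regularAtInfinity : Subring (MonicLoc A) where
  carrier := {x | ∃ a f : A[X], f.Monic ∧ a.degree ≤ f.degree ∧
    x * algebraMap A[X] (MonicLoc A) f = algebraMap A[X] (MonicLoc A) a}
  one_mem' := ⟨1, 1, monic_one, le_rfl, by simp⟩
  zero_mem' := ⟨0, 1, monic_one, by simp, by simp⟩
  neg_mem' := by
    rintro x ⟨a, f, hf, hd, h⟩
    exact ⟨-a, f, hf, by rwa [degree_neg], by rw [map_neg, ← h]; ring⟩
  mul_mem' := by
    rintro x y ⟨a, f, hf, hd, h⟩ ⟨b, g, hg, hd', h'⟩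
    refine ⟨a * b, f * g, hf.mul hg, ?_, ?_⟩
    · rw [degree_mul, degree_mul]
      exact add_le_add hd hd'
    · rw [map_mul, map_mul, ← h, ← h']; ring
  add_mem' := by
    rintro x y ⟨a, f, hf, hd, h⟩ ⟨b, g, hg, hd', h'⟩
    refine ⟨a * g + b * f, f * g, hf.mul hg, ?_, ?_⟩
    · refine (degree_add_le _ _).trans (max_le ?_ ?_) <;> rw [degree_mul, degree_mul]
      · exact add_le_add hd le_rfl
      · rw [add_comm]
        exact add_le_add le_rfl hd'
    · rw [map_add, map_mul, map_mul, map_mul, ← h, ← h']; ring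

/-- The fractions with monic denominator that vanish at infinity. -/
def vanishingAtInfinity : Submodule A (MonicLoc A) where
  carrier := {x | ∃ a f : A[X], f.Monic ∧ a.degree < f.degree ∧
    x * algebraMap A[X] (MonicLoc A) f = algebraMap A[X] (MonicLoc A) a}
  zero_mem' := ⟨0, 1, monic_one, by simp, by simp⟩
  add_mem' := by
    rintro x y ⟨a, f, hf, hd, h⟩ ⟨b, g, hg, hd', h'⟩
    refine ⟨a * g + b * f, f * g, hf.mul hg, ?_, ?_⟩
    · refine (degree_add_le _ _).trans_lt (max_lt ?_ ?_) <;> rw [degree_mul, degree_mul]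
      · exact WithBot.add_lt_add_right (degree_ne_bot.mpr hg.ne_zero) hd
      · rw [add_comm]
        exact WithBot.add_lt_add_left (degree_ne_bot.mpr hf.ne_zero) hd'
    · rw [map_add, map_mul, map_mul, map_mul, ← h, ← h']; ring
  smul_mem' := by
    rintro c x ⟨a, f, hf, hd, h⟩
    refine ⟨c • a, f, hf, (degree_smul_le c a).trans_lt hd, ?_⟩
    rw [smul_mul_assoc, h]
    exact ((IsScalarTower.toAlgHom A A[X] (MonicLoc A)).toLinearMap.map_smul c a).symm

variable {A}

theorem regularAtInfinity_of_vanishing {x : MonicLoc A} (hx : x ∈ vanishingAtInfinity A) :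
    x ∈ regularAtInfinity A := by
  obtain ⟨a, f, hf, hd, h⟩ := hx
  exact ⟨a, f, hf, hd.le, h⟩

theorem mul_mem_vanishingAtInfinity {x y : MonicLoc A} (hx : x ∈ regularAtInfinity A)
    (hy : y ∈ vanishingAtInfinity A) : x * y ∈ vanishingAtInfinity A := by
  obtain ⟨a, f, hf, hd, h⟩ := hx
  obtain ⟨b, g, hg, hd', h'⟩ := hy
  refine ⟨a * b, f * g, hf.mul hg, ?_, ?_⟩
  · rw [degree_mul, degree_mul]
    exact (add_le_add hd le_rfl).trans_lt
      (WithBot.add_lt_add_left (degree_ne_bot.mpr hf.ne_zero) hd')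
  · rw [map_mul, map_mul, ← h, ← h']; ring

theorem isUnit_of_sub_one_mem_vanishingAtInfinity {x : MonicLoc A}
    (hx : x - 1 ∈ vanishingAtInfinity A) : IsUnit x := by
  obtain ⟨a, f, hf, hd, h⟩ := hx
  have h1 : x * algebraMap A[X] (MonicLoc A) f = algebraMap A[X] (MonicLoc A) (f + a) := by
    rw [map_add, ← h]; ring
  exact isUnit_of_mul_isUnit_left
    (h1 ▸ MonicLoc.isUnit_algebraMap (hf.add_of_left hd))

theorem det_sub_one_mem {W : Type*} [CommRing W] (V : Ideal W) {r : ℕ}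
    (M : Matrix (Fin r) (Fin r) W) (h : ∀ i j, M i j - (1 : Matrix (Fin r) (Fin r) W) i j ∈ V) :
    M.det - 1 ∈ V := by
  rw [← Ideal.Quotient.eq, RingHom.map_det]
  have : (Ideal.Quotient.mk V).mapMatrix M = (Ideal.Quotient.mk V).mapMatrix 1 := by
    ext i j
    exact (Ideal.Quotient.eq).mpr (h i j)
  rw [this, map_one, map_one, Matrix.det_one]

theorem isUnit_one_sub_of_vanishingAtInfinity {r : ℕ} (M : Matrix (Fin r) (Fin r) (MonicLoc A))
    (h : ∀ i j, M i j ∈ vanishingAtInfinity A) : IsUnit (1 - M) := by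
  rw [Matrix.isUnit_iff_isUnit_det]
  let V : Ideal (regularAtInfinity A) :=
    { carrier := {w | w.1 ∈ vanishingAtInfinity A}
      zero_mem' := (vanishingAtInfinity A).zero_mem
      add_mem' := fun ha hb => (vanishingAtInfinity A).add_mem ha hb
      smul_mem' := fun c _ hx => mul_mem_vanishingAtInfinity c.2 hx }
  let M' : Matrix (Fin r) (Fin r) (regularAtInfinity A) :=
    fun i j => ⟨M i j, regularAtInfinity_of_vanishing (h i j)⟩
  have h1 : (1 - M').det - 1 ∈ V := by
    refine det_sub_one_mem V _ fun i j => ?_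
    rw [Matrix.sub_apply, sub_sub_cancel_left]
    exact V.neg_mem (h i j)
  have h2 : ((1 - M').det : MonicLoc A) = (1 - M).det := by
    change (regularAtInfinity A).subtype _ = _
    rw [RingHom.map_det, map_sub, map_one]
    rfl
  refine isUnit_of_sub_one_mem_vanishingAtInfinity ?_
  rw [← h2]
  exact h1

theorem exists_eq_algebraMap_add_vanishing (x : MonicLoc A) :
    ∃ g : A[X], ∃ b ∈ vanishingAtInfinity A, x = algebraMap A[X] (MonicLoc A) g + b := by
  obtain ⟨a, f, hf, h⟩ := x.exists_mul_eq
  refine ⟨a /ₘ f, x - algebraMap A[X] (MonicLoc A) (a /ₘ f),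
    ⟨a %ₘ f, f, hf, degree_modByMonic_lt a hf, ?_⟩, by ring⟩
  rw [sub_mul, h, ← map_mul, ← map_sub]
  congr 1
  rw [modByMonic_eq_sub_mul_div]
  ring

end Proper

section Residue

variable {A : Type*} [CommRing A] [IsLocalRing A]

variable (A) in
/-- Reduction of `A⟨X⟩` to the field of rational functions over the residue field. -/
noncomputable def MonicLoc.residueHom :
    MonicLoc A →+* FractionRing (ResidueField A)[X] :=
  IsLocalization.lift (M := monicSubmonoid A)
    (g := (algebraMap (ResidueField A)[X] (FractionRing (ResidueField A)[X])).comp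
      (mapRingHom (residue A)))
    (fun f => by
      rw [RingHom.comp_apply, isUnit_iff_ne_zero]
      refine (map_ne_zero_iff _ (IsFractionRing.injective _ _)).mpr ?_
      exact ((mem_monicSubmonoid.mp f.2).map (residue A)).ne_zero)

theorem MonicLoc.residueHom_algebraMap (a : A[X]) :
    MonicLoc.residueHom A (algebraMap A[X] (MonicLoc A) a) =
      algebraMap _ (FractionRing (ResidueField A)[X]) (a.map (residue A)) :=
  IsLocalization.lift_eq _ a

theorem exists_map_residue_eq (p : (ResidueField A)[X]) : ∃ a : A[X], a.map (residue A) = p :=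
  Polynomial.map_surjective _ residue_surjective p

theorem MonicLoc.exists_isUnit_residueHom_eq_algebraMap {p : (ResidueField A)[X]} (hp : p ≠ 0) :
    ∃ x : MonicLoc A, IsUnit x ∧ MonicLoc.residueHom A x = algebraMap _ _ p := by
  obtain ⟨c, hc⟩ := residue_surjective (R := A) p.leadingCoeff
  have hcu : IsUnit c := by
    rw [← residue_ne_zero_iff_isUnit, hc]
    exact leadingCoeff_ne_zero.mpr hp
  have hm : (p * C p.leadingCoeff⁻¹).Monic := monic_mul_leadingCoeff_inv hp
  obtain ⟨q, hq, -, hqm⟩ := lifts_and_degree_eq_and_monic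
    ((mem_lifts _).mpr (exists_map_residue_eq (p * C p.leadingCoeff⁻¹))) hm
  refine ⟨algebraMap A[X] _ (q * C c), ?_, ?_⟩
  · rw [map_mul]
    exact (MonicLoc.isUnit_algebraMap hqm).mul ((hcu.map C).map _)
  · rw [MonicLoc.residueHom_algebraMap, Polynomial.map_mul, hq, map_C, hc, mul_assoc, ← C_mul,
      inv_mul_cancel₀ (leadingCoeff_ne_zero.mpr hp), C_1, mul_one]

theorem MonicLoc.exists_isUnit_residueHom_eq {y : FractionRing (ResidueField A)[X]} (hy : y ≠ 0) :
    ∃ x : MonicLoc A, IsUnit x ∧ MonicLoc.residueHom A x = y := by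
  obtain ⟨a, b, hb, rfl⟩ := IsFractionRing.div_surjective (A := (ResidueField A)[X]) y
  have hb0 : b ≠ 0 := nonZeroDivisors.ne_zero hb
  have ha0 : a ≠ 0 := by
    rintro rfl
    simp at hy
  obtain ⟨x, hx, hx'⟩ := exists_isUnit_residueHom_eq_algebraMap ha0
  obtain ⟨z, hz, hz'⟩ := exists_isUnit_residueHom_eq_algebraMap hb0
  obtain ⟨z, rfl⟩ := hz
  refine ⟨x * ↑z⁻¹, hx.mul (Units.isUnit _), ?_⟩
  rw [map_mul, hx', div_eq_mul_inv, ← hz', map_units_inv]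

theorem MonicLoc.residueHom_surjective : Function.Surjective (MonicLoc.residueHom A) := by
  intro y
  by_cases hy : y = 0
  · exact ⟨0, by rw [map_zero, hy]⟩
  · obtain ⟨x, -, hx⟩ := exists_isUnit_residueHom_eq hy
    exact ⟨x, hx⟩

theorem mem_map_of_map_residue_eq_zero {a : A[X]} (ha : a.map (residue A) = 0) :
    ∀ i, a.coeff i ∈ maximalIdeal A := by
  intro i
  rw [← residue_eq_zero_iff, ← coeff_map, ha, coeff_zero]

theorem mem_smul_top_of_map_residue_eq_zero {a : A[X]} (ha : a.map (residue A) = 0) :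
    a ∈ maximalIdeal A • (⊤ : Submodule A A[X]) := by
  rw [a.as_sum_range_C_mul_X_pow]
  refine Submodule.sum_mem _ fun i _ => ?_
  rw [← smul_eq_C_mul]
  exact Submodule.smul_mem_smul (mem_map_of_map_residue_eq_zero ha i) trivial

theorem MonicLoc.mem_smul_top_of_residueHom_eq_zero {x : MonicLoc A}
    (hx : MonicLoc.residueHom A x = 0) : x ∈ maximalIdeal A • (⊤ : Submodule A (MonicLoc A)) := by
  obtain ⟨a, f, hf, h⟩ := x.exists_mul_eq
  have ha : a.map (residue A) = 0 := by
    have := congrArg (MonicLoc.residueHom A) h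
    rw [map_mul, hx, zero_mul, MonicLoc.residueHom_algebraMap] at this
    exact (map_eq_zero_iff _ (IsFractionRing.injective _ _)).mp this.symm
  obtain ⟨g, hg⟩ := (MonicLoc.isUnit_algebraMap hf).exists_right_inv
  have hxa : x = g * algebraMap A[X] (MonicLoc A) a := by
    rw [← h, mul_left_comm, mul_comm g, hg, mul_one]
  let T : A[X] →ₗ[A] MonicLoc A :=
    LinearMap.mulLeft A g ∘ₗ (IsScalarTower.toAlgHom A A[X] (MonicLoc A)).toLinearMap
  have h1 : T a ∈ (maximalIdeal A • (⊤ : Submodule A A[X])).map T :=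
    Submodule.mem_map_of_mem (mem_smul_top_of_map_residue_eq_zero ha)
  rw [Submodule.map_smul''] at h1
  rw [hxa]
  exact Submodule.smul_mono le_rfl le_top h1

/-- Invertible matrices over `k(X)` lift to invertible matrices over `A⟨X⟩`. -/
theorem MonicLoc.exists_isUnit_map_eq {r : ℕ}
    (M : Matrix (Fin r) (Fin r) (FractionRing (ResidueField A)[X])) (hM : M.det ≠ 0) :
    ∃ Γ : Matrix (Fin r) (Fin r) (MonicLoc A), IsUnit Γ ∧ Γ.map (MonicLoc.residueHom A) = M := by
  refine Matrix.diagonal_transvection_induction_of_det_ne_zero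
    (fun M => ∃ Γ : Matrix (Fin r) (Fin r) (MonicLoc A),
      IsUnit Γ ∧ Γ.map (MonicLoc.residueHom A) = M) M hM ?_ ?_ ?_
  · intro D hD
    rw [Matrix.det_diagonal, Finset.prod_ne_zero_iff] at hD
    choose x hx hx' using fun i => exists_isUnit_residueHom_eq (hD i (Finset.mem_univ i))
    refine ⟨Matrix.diagonal x, ?_, ?_⟩
    · rw [Matrix.isUnit_iff_isUnit_det, Matrix.det_diagonal]
      exact IsUnit.prod_univ_iff.mpr hx
    · rw [Matrix.diagonal_map (map_zero _)]
      congr 1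
      exact funext hx'
  · intro t
    obtain ⟨x, hx⟩ := residueHom_surjective (A := A) t.c
    refine ⟨Matrix.transvection t.i t.j x, ?_, ?_⟩
    · rw [Matrix.isUnit_iff_isUnit_det, Matrix.det_transvection_of_ne _ _ t.hij]
      exact isUnit_one
    · rw [Matrix.TransvectionStruct.toMatrix, Matrix.transvection, Matrix.transvection,
        Matrix.map_add _ (map_add _), Matrix.map_one _ (map_zero _) (map_one _),
        Matrix.map_single, hx]
  · rintro M N - - ⟨Γ, h1, rfl⟩ ⟨Δ, h2, rfl⟩
    exact ⟨Γ * Δ, h1.mul h2, Matrix.map_mul⟩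

end Residue
/-- Polynomials of bounded degree in each coordinate, mapped to `Y ^ n`. -/
theorem exists_fg_of_monic {A Y : Type*} [CommRing A] [Nontrivial A] [AddCommGroup Y] [Module A Y]
    (T : A[X] →ₗ[A] Y) {f : A[X]} (hf : f.Monic) (n : ℕ) :
    ∃ G : Submodule A (Fin n → Y), G.FG ∧ ∀ g : Fin n → A[X], (fun i => T (g i %ₘ f)) ∈ G := by
  have : Module.Finite A (degreeLT A f.natDegree) :=
    Module.Finite.equiv (degreeLTEquiv A f.natDegree).symm
  let S : (Fin n → degreeLT A f.natDegree) →ₗ[A] (Fin n → Y) :=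
    (T ∘ₗ (degreeLT A f.natDegree).subtype).compLeft (Fin n)
  refine ⟨LinearMap.range S, ?_, fun g => ?_⟩
  · rw [LinearMap.range_eq_map]
    exact Module.Finite.fg_top.map S
  · refine ⟨fun i => ⟨g i %ₘ f, ?_⟩, rfl⟩
    rw [mem_degreeLT, ← degree_eq_natDegree hf.ne_zero]
    exact degree_modByMonic_lt _ hf

theorem exists_monic_mul_eq_map {A : Type*} [CommRing A] {m n : ℕ}
    (u : Matrix (Fin m) (Fin n) (MonicLoc A)) :
    ∃ f : A[X], f.Monic ∧ ∃ u' : Matrix (Fin m) (Fin n) A[X],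
      algebraMap A[X] (MonicLoc A) f • u = u'.map (algebraMap A[X] (MonicLoc A)) := by
  obtain ⟨f, hf⟩ := IsLocalization.exist_integer_multiples_of_finite (monicSubmonoid A)
    (fun p : Fin m × Fin n => u p.1 p.2)
  choose g hg using hf
  refine ⟨f.1, f.2, Matrix.of fun i j => g (i, j), ?_⟩
  ext i j
  rw [Matrix.smul_apply, Matrix.map_apply, Matrix.of_apply, hg, Algebra.smul_def, smul_eq_mul]

/-- Vectors whose image under `u` is polynomial. -/
noncomputable def polynomialPreimage {A : Type*} [CommRing A] {N r : ℕ}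
    (u : Matrix (Fin N) (Fin r) (MonicLoc A)) :
    Submodule A (Fin r → MonicLoc A) where
  carrier := {y | ∃ g : Fin N → A[X], u.mulVec y = algebraMap A[X] (MonicLoc A) ∘ g}
  zero_mem' := ⟨0, by rw [Matrix.mulVec_zero]; ext; simp⟩
  add_mem' := by
    rintro x y ⟨g, hg⟩ ⟨h, hh⟩
    refine ⟨g + h, ?_⟩
    rw [Matrix.mulVec_add, hg, hh]
    ext; simp
  smul_mem' := by
    rintro c x ⟨g, hg⟩
    refine ⟨c • g, ?_⟩
    rw [Matrix.mulVec_smul, hg]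
    funext i
    exact ((IsScalarTower.toAlgHom A A[X] (MonicLoc A)).toLinearMap.map_smul c (g i)).symm

section LocalHorrocks

variable {A : Type*} [CommRing A] [IsLocalRing A]

theorem exists_matrix_map_residue_eq {m n : ℕ} (M : Matrix (Fin m) (Fin n) (ResidueField A)[X]) :
    ∃ Q : Matrix (Fin m) (Fin n) A[X], Q.map (mapRingHom (residue A)) = M := by
  choose q hq using fun i j => exists_map_residue_eq (M i j)
  exact ⟨Matrix.of q, Matrix.ext hq⟩

/-- The two trivializations, over `A⟨X⟩` and over the residue field, can be made compatible. -/
theorem exists_compatible_trivializations {N : ℕ} {e : Matrix (Fin N) (Fin N) A[X]}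
    (he : e * e = e) (h : IsFreeIdem (e.map (algebraMap A[X] (MonicLoc A)))) :
    ∃ (r : ℕ) (u : Matrix (Fin N) (Fin r) (MonicLoc A)) (v : Matrix (Fin r) (Fin N) (MonicLoc A))
      (u₀ : Matrix (Fin N) (Fin r) (ResidueField A)[X])
      (v₀ : Matrix (Fin r) (Fin N) (ResidueField A)[X]),
      u * v = e.map (algebraMap A[X] (MonicLoc A)) ∧ v * u = 1 ∧
      u₀ * v₀ = e.map (mapRingHom (residue A)) ∧ v₀ * u₀ = 1 ∧
      u.map (MonicLoc.residueHom A) = u₀.map (algebraMap _ _) := by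
  obtain ⟨r', u₀, v₀, h1, h2⟩ := idemFree_of_isPrincipalIdealRing (ResidueField A)[X] N
    (e.map (mapRingHom (residue A))) (by rw [← Matrix.map_mul, he])
  obtain ⟨r, u, v, h3, h4⟩ := h
  let κ := FractionRing (ResidueField A)[X]
  let ψ := MonicLoc.residueHom A
  let ι : (ResidueField A)[X] →+* κ := algebraMap _ _
  have hκ : u.map ψ * v.map ψ = u₀.map ι * v₀.map ι := by
    rw [← Matrix.map_mul, ← Matrix.map_mul, h1, h3, Matrix.map_map, Matrix.map_map]
    ext i j
    exact MonicLoc.residueHom_algebraMap _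
  have h2κ : v₀.map ι * u₀.map ι = 1 := by
    rw [← Matrix.map_mul, h2, Matrix.map_one _ (map_zero _) (map_one _)]
  have h4κ : v.map ψ * u.map ψ = 1 := by
    rw [← Matrix.map_mul, h4, Matrix.map_one _ (map_zero _) (map_one _)]
  have hγδ : (v.map ψ * u₀.map ι) * (v₀.map ι * u.map ψ) = 1 := by
    rw [Matrix.mul_assoc, ← Matrix.mul_assoc (u₀.map ι), ← hκ, Matrix.mul_assoc (u.map ψ), h4κ,
      Matrix.mul_one, h4κ]
  have hδγ : (v₀.map ι * u.map ψ) * (v.map ψ * u₀.map ι) = 1 := by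
    rw [Matrix.mul_assoc, ← Matrix.mul_assoc (u.map ψ), hκ, Matrix.mul_assoc (u₀.map ι), h2κ,
      Matrix.mul_one, h2κ]
  obtain rfl : r' = r := by
    simpa using Matrix.square_of_invertible _ _ hδγ hγδ
  obtain ⟨Γ, ⟨Γ, rfl⟩, hΓ⟩ := MonicLoc.exists_isUnit_map_eq (v.map ψ * u₀.map ι)
    (Matrix.isUnit_iff_isUnit_det _ |>.mp ⟨⟨_, _, hγδ, hδγ⟩, rfl⟩).ne_zero
  refine ⟨_, u * Γ.1, Γ⁻¹.1 * v, u₀, v₀, ?_, ?_, h1, h2, ?_⟩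
  · rw [Matrix.mul_assoc, ← Matrix.mul_assoc Γ.1, Units.mul_inv, Matrix.one_mul, h3]
  · rw [Matrix.mul_assoc, ← Matrix.mul_assoc v, h4, Matrix.one_mul, Units.inv_mul]
  · rw [Matrix.map_mul, hΓ, ← Matrix.mul_assoc, hκ, Matrix.mul_assoc, h2κ, Matrix.mul_one]

theorem exists_map_residue_eq_zero_of_mem_smul {N r : ℕ}
    {u : Matrix (Fin N) (Fin r) (MonicLoc A)} {y : Fin r → MonicLoc A}
    (hy : y ∈ maximalIdeal A • polynomialPreimage u) :
    ∃ g : Fin N → A[X], (∀ i, (g i).map (residue A) = 0) ∧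
      u.mulVec y = algebraMap A[X] (MonicLoc A) ∘ g := by
  induction hy using Submodule.smul_induction_on' with
  | smul c hc y hy =>
    obtain ⟨g, hg⟩ := hy
    refine ⟨c • g, fun i => ?_, ?_⟩
    · rw [Pi.smul_apply, smul_eq_C_mul, Polynomial.map_mul, map_C, (residue_eq_zero_iff c).mpr hc,
        C_0, zero_mul]
    · rw [Matrix.mulVec_smul, hg]
      funext i
      exact ((IsScalarTower.toAlgHom A A[X] (MonicLoc A)).toLinearMap.map_smul c (g i)).symm
  | add x hx y hy h1 h2 =>
    obtain ⟨g, hg, hg'⟩ := h1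
    obtain ⟨h, hh, hh'⟩ := h2
    refine ⟨g + h, fun i => ?_, ?_⟩
    · rw [Pi.add_apply, Polynomial.map_add, hg, hh, add_zero]
    · rw [Matrix.mulVec_add, hg', hh']
      ext; simp

/-- If a trivialization over `A⟨X⟩` is given by a polynomial matrix which also trivializes over
the residue field, then it is a trivialization over `A[X]`. -/
theorem isFreeIdem_of_polynomial_trivialization {N r : ℕ} {e : Matrix (Fin N) (Fin N) A[X]}
    (he : e * e = e) {w : Matrix (Fin N) (Fin r) A[X]} {z : Matrix (Fin r) (Fin N) (MonicLoc A)}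
    (hwz : w.map (algebraMap A[X] (MonicLoc A)) * z = e.map (algebraMap A[X] (MonicLoc A)))
    (hzw : z * w.map (algebraMap A[X] (MonicLoc A)) = 1)
    {v₀ : Matrix (Fin r) (Fin N) (ResidueField A)[X]}
    (hv₀ : w.map (mapRingHom (residue A)) * v₀ = e.map (mapRingHom (residue A))) :
    IsFreeIdem e := by
  let α := algebraMap A[X] (MonicLoc A)
  have hα : Function.Injective α := MonicLoc.algebraMap_injective A
  have hew : e * w = w := by
    apply Matrix.map_injective hα
    beta_reduce
    rw [Matrix.map_mul, ← hwz, Matrix.mul_assoc, hzw, Matrix.mul_one]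
  let N₂ : Submodule A (Fin N → A[X]) :=
    (LinearMap.range (w.mulVecLin) ⊔ LinearMap.range ((1 - e).mulVecLin)).restrictScalars A
  have hN₂ : N₂ = ⊤ := by
    obtain ⟨f, hf, z', hz'⟩ := exists_monic_mul_eq_map z
    obtain ⟨G, hG, hGmem⟩ := exists_fg_of_monic (LinearMap.id : A[X] →ₗ[A] A[X]) hf N
    have hfe : f • e = w * z' := by
      apply Matrix.map_injective hα
      beta_reduce
      rw [Matrix.map_mul, ← hz', Matrix.mul_smul, hwz]
      ext i j
      simp [α]
    refine eq_top_of_sup_maximalIdeal_smul_eq_top hG ?_ ?_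
    · refine eq_top_iff.mpr fun g _ => ?_
      have hg : g = (fun i => g i %ₘ f) + f • (fun i => g i /ₘ f) := by
        funext i
        exact (modByMonic_add_div (g i) f).symm
      rw [hg]
      refine Submodule.add_mem_sup (hGmem g) ?_
      set h : Fin N → A[X] := fun i => g i /ₘ f
      have h1 : f • h = w.mulVec (z'.mulVec h) + (1 - e).mulVec (f • h) := by
        rw [Matrix.mulVec_mulVec, ← hfe, Matrix.sub_mulVec, Matrix.one_mulVec,
          Matrix.mulVec_smul, Matrix.smul_mulVec, add_sub_cancel]
      rw [h1]
      exact Submodule.add_mem_sup ⟨_, rfl⟩ ⟨_, rfl⟩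
    · refine eq_top_iff.mpr fun g _ => ?_
      obtain ⟨v₁, rfl⟩ := exists_matrix_map_residue_eq v₀
      have hg : g = (w.mulVec (v₁.mulVec g) + (1 - e).mulVec g) + (e - w * v₁).mulVec g := by
        rw [Matrix.sub_mulVec, Matrix.sub_mulVec, Matrix.one_mulVec, Matrix.mulVec_mulVec]
        abel
      rw [hg]
      refine Submodule.add_mem_sup (Submodule.add_mem_sup ⟨_, rfl⟩ ⟨_, rfl⟩) ?_
      refine pi_mem_smul_top _ fun i => mem_smul_top_of_map_residue_eq_zero ?_
      change mapRingHom (residue A) _ = 0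
      rw [RingHom.map_mulVec, Matrix.map_sub _ (map_sub _), Matrix.map_mul, hv₀, sub_self,
        Matrix.zero_mulVec]
      rfl
  have hcol : ∀ j, ∃ x : Fin r → A[X], w.mulVec x = e.col j := by
    intro j
    have : e.col j ∈ N₂ := hN₂ ▸ trivial
    obtain ⟨_, ⟨x, rfl⟩, _, ⟨y, rfl⟩, h⟩ := Submodule.mem_sup.mp this
    refine ⟨x, ?_⟩
    have h1 := congrArg e.mulVec h
    rw [Matrix.mulVecLin_apply, Matrix.mulVecLin_apply, Matrix.mulVec_add, Matrix.mulVec_mulVec,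
      Matrix.mulVec_mulVec, hew, Matrix.mul_sub, he, Matrix.mul_one, sub_self, Matrix.zero_mulVec,
      add_zero] at h1
    rw [h1]
    funext i
    exact congrFun (congrFun he i) j
  choose x hx using hcol
  have hwx : w * (Matrix.of x).transpose = e := by
    ext1 i j
    exact congrFun (hx j) i
  refine ⟨r, w, (Matrix.of x).transpose, hwx, ?_⟩
  apply Matrix.map_injective hα
  beta_reduce
  rw [Matrix.map_mul, Matrix.map_one α (map_zero α) (map_one α)]
  calc (Matrix.of x).transpose.map α * w.map α
      = z * (w.map α * (Matrix.of x).transpose.map α) * w.map α := by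
        rw [← Matrix.mul_assoc z, hzw, Matrix.one_mul]
    _ = z * (w.map α * z) * w.map α := by rw [← Matrix.map_mul, hwx, hwz]
    _ = 1 := by rw [← Matrix.mul_assoc z, hzw, Matrix.one_mul, hzw]

variable [IsDomain A]

/-- Vectors vanishing at infinity. -/
noncomputable def vanishingVectors (A : Type*) [CommRing A] [IsDomain A] (r : ℕ) :
    Submodule A (Fin r → MonicLoc A) :=
  Submodule.pi Set.univ fun _ => vanishingAtInfinity A

theorem polynomialPreimage_sup_vanishingVectors {N r : ℕ}
    {e : Matrix (Fin N) (Fin N) A[X]} {u : Matrix (Fin N) (Fin r) (MonicLoc A)}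
    {v : Matrix (Fin r) (Fin N) (MonicLoc A)}
    (huv : u * v = e.map (algebraMap A[X] (MonicLoc A))) (hvu : v * u = 1)
    {q : Matrix (Fin N) (Fin r) A[X]}
    (hq : u.map (MonicLoc.residueHom A) =
      (q.map (algebraMap A[X] (MonicLoc A))).map (MonicLoc.residueHom A)) :
    polynomialPreimage u ⊔ vanishingVectors A r = ⊤ := by
  let α := algebraMap A[X] (MonicLoc A)
  have hsplit : ∀ y : Fin r → MonicLoc A, ∃ g : Fin r → A[X], ∃ b ∈ vanishingVectors A r,
      y = α ∘ g + b := by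
    intro y
    choose g b hb h using fun i => exists_eq_algebraMap_add_vanishing (y i)
    exact ⟨g, b, fun i _ => hb i, funext h⟩
  obtain ⟨f, hf, u', hu'⟩ := exists_monic_mul_eq_map u
  obtain ⟨G, hG, hGmem⟩ := exists_fg_of_monic
    (IsScalarTower.toAlgHom A A[X] (MonicLoc A)).toLinearMap hf r
  refine eq_top_of_sup_maximalIdeal_smul_eq_top hG ?_ ?_
  · refine eq_top_iff.mpr fun y _ => ?_
    obtain ⟨g, b, hb, rfl⟩ := hsplit y
    have hg : α ∘ g = (α ∘ fun i => g i %ₘ f) + α f • (α ∘ fun i => g i /ₘ f) := by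
      funext i
      simp only [Function.comp_apply, Pi.add_apply, Pi.smul_apply, smul_eq_mul, ← map_mul,
        ← map_add, modByMonic_add_div]
    rw [hg, add_assoc]
    refine Submodule.add_mem_sup (hGmem g) (Submodule.add_mem_sup ?_ hb)
    refine ⟨u'.mulVec fun i => g i /ₘ f, ?_⟩
    rw [Matrix.mulVec_smul, ← Matrix.smul_mulVec, hu']
    exact (funext (RingHom.map_mulVec α u' _)).symm
  · refine eq_top_iff.mpr fun y _ => ?_
    obtain ⟨g, b, hb, rfl⟩ := hsplit y
    have hg : α ∘ g = v.mulVec (α ∘ (q.mulVec g)) +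
        (v * (u - q.map α)).mulVec (α ∘ g) := by
      have : α ∘ (q.mulVec g) = (q.map α).mulVec (α ∘ g) := funext (RingHom.map_mulVec α q g)
      rw [this, Matrix.mulVec_mulVec, ← Matrix.add_mulVec, ← Matrix.mul_add, add_sub_cancel, hvu,
        Matrix.one_mulVec]
    rw [hg, add_right_comm]
    refine Submodule.add_mem_sup (Submodule.add_mem_sup ?_ hb) ?_
    · refine ⟨e.mulVec (q.mulVec g), ?_⟩
      rw [Matrix.mulVec_mulVec, huv]
      exact (funext (RingHom.map_mulVec α e _)).symm
    · refine pi_mem_smul_top _ fun i => MonicLoc.mem_smul_top_of_residueHom_eq_zero ?_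
      rw [RingHom.map_mulVec, Matrix.map_mul, Matrix.map_sub _ (map_sub _), hq, sub_self,
        Matrix.mul_zero, Matrix.zero_mulVec]
      rfl

/-- **Horrocks' theorem** for idempotent matrices over a local domain. -/
theorem isFreeIdem_of_isFreeIdem_monicLoc {N : ℕ} {e : Matrix (Fin N) (Fin N) A[X]}
    (he : e * e = e) (h : IsFreeIdem (e.map (algebraMap A[X] (MonicLoc A)))) : IsFreeIdem e := by
  obtain ⟨r, u, v, u₀, v₀, huv, hvu, huv₀, hvu₀, hu⟩ := exists_compatible_trivializations he h
  let α := algebraMap A[X] (MonicLoc A)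
  let ρ := mapRingHom (residue A)
  obtain ⟨q₀, hq₀⟩ := exists_matrix_map_residue_eq u₀
  let q := e * q₀
  have hq : q.map ρ = u₀ := by
    rw [Matrix.map_mul, hq₀, ← huv₀, Matrix.mul_assoc, hvu₀, Matrix.mul_one]
  have heq : e * q = q := by rw [← Matrix.mul_assoc, he]
  have hu' : u.map (MonicLoc.residueHom A) = (q.map α).map (MonicLoc.residueHom A) := by
    rw [hu, ← hq, Matrix.map_map, Matrix.map_map]
    ext i j
    exact (MonicLoc.residueHom_algebraMap _).symm
  have htop := polynomialPreimage_sup_vanishingVectors huv hvu hu'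
  have hcol : ∀ j, ∃ (y b : Fin r → MonicLoc A) (g : Fin N → A[X]),
      (v * (u - q.map α)).col j = y + b ∧ b ∈ vanishingVectors A r ∧
      (∀ i, (g i).map (residue A) = 0) ∧ u.mulVec y = α ∘ g := by
    intro j
    have h1 : (v * (u - q.map α)).col j ∈
        maximalIdeal A • (⊤ : Submodule A (Fin r → MonicLoc A)) := by
      refine pi_mem_smul_top _ fun i => MonicLoc.mem_smul_top_of_residueHom_eq_zero ?_
      change ((v * (u - q.map α)).map (MonicLoc.residueHom A)) i j = 0
      rw [Matrix.map_mul, Matrix.map_sub _ (map_sub _), hu', sub_self, Matrix.mul_zero]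
      rfl
    rw [← htop, Submodule.smul_sup] at h1
    obtain ⟨y, hy, b, hb, hyb⟩ := Submodule.mem_sup.mp h1
    obtain ⟨g, hg, hg'⟩ := exists_map_residue_eq_zero_of_mem_smul hy
    exact ⟨y, b, g, hyb.symm, Submodule.smul_le_right hb, hg, hg'⟩
  choose y b g hyb hb hg hyg using hcol
  let Y := (Matrix.of y).transpose
  let B := (Matrix.of b).transpose
  let g' := (Matrix.of g).transpose
  have hYB : v * (u - q.map α) = Y + B := by
    ext i j
    exact congrFun (hyb j) i
  have huY : u * Y = g'.map α := by
    ext i j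
    exact congrFun (hyg j) i
  have hg'0 : g'.map ρ = 0 := by
    ext1 i j
    exact hg j i
  have hw : (q + g').map α = u * (1 - B) := by
    have h1 : u * (v * (u - q.map α)) = u - q.map α := by
      rw [Matrix.mul_sub, hvu, Matrix.mul_sub, Matrix.mul_one, ← Matrix.mul_assoc, huv,
        ← Matrix.map_mul, heq]
    rw [hYB, Matrix.mul_add, huY] at h1
    rw [Matrix.map_add _ (map_add _), Matrix.mul_sub, Matrix.mul_one, eq_sub_iff_add_eq,
      add_assoc, h1, add_sub_cancel]
  obtain ⟨Δ, hΔ⟩ := isUnit_one_sub_of_vanishingAtInfinity B fun i j => hb j i trivial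
  refine isFreeIdem_of_polynomial_trivialization he (w := q + g') (z := Δ⁻¹.1 * v) (v₀ := v₀)
    ?_ ?_ ?_
  · rw [hw, ← hΔ, Matrix.mul_assoc, ← Matrix.mul_assoc Δ.1, Units.mul_inv, Matrix.one_mul, huv]
  · rw [hw, ← hΔ, Matrix.mul_assoc, ← Matrix.mul_assoc v, hvu, Matrix.one_mul, Units.inv_mul]
  · rw [Matrix.map_add _ (map_add _), hg'0, add_zero, hq, huv₀]

end LocalHorrocks

end Horrocks

section Patching

/-- Equivalence of idempotent matrices: their images are isomorphic. -/
def IdemEquiv {R : Type*} [CommRing R] {N : ℕ} (e f : Matrix (Fin N) (Fin N) R) : Prop :=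
  ∃ u v : Matrix (Fin N) (Fin N) R, u * v = e ∧ v * u = f

theorem IdemEquiv.map {R S : Type*} [CommRing R] [CommRing S] {N : ℕ}
    {e f : Matrix (Fin N) (Fin N) R} (h : IdemEquiv e f) (φ : R →+* S) :
    IdemEquiv (e.map φ) (f.map φ) := by
  obtain ⟨u, v, rfl, rfl⟩ := h
  exact ⟨u.map φ, v.map φ, Matrix.map_mul.symm, Matrix.map_mul.symm⟩

theorem IdemEquiv.trans {R : Type*} [CommRing R] {N : ℕ} {e f g : Matrix (Fin N) (Fin N) R}
    (he : e * e = e) (hg : g * g = g) (h : IdemEquiv e f) (h' : IdemEquiv f g) :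
    IdemEquiv e g := by
  obtain ⟨u, v, rfl, rfl⟩ := h
  obtain ⟨a, b, hab, rfl⟩ := h'
  refine ⟨u * a, b * v, ?_, ?_⟩
  · rw [Matrix.mul_assoc, ← Matrix.mul_assoc a, hab, ← he]
    simp only [Matrix.mul_assoc]
  · rw [Matrix.mul_assoc, ← Matrix.mul_assoc v, ← hab, ← hg]
    simp only [Matrix.mul_assoc]

theorem IdemEquiv.isFreeIdem {R : Type*} [CommRing R] {N : ℕ} {e f : Matrix (Fin N) (Fin N) R}
    (he : e * e = e) (h : IdemEquiv e f) (hf : IsFreeIdem f) : IsFreeIdem e := by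
  obtain ⟨a, b, rfl, rfl⟩ := h
  obtain ⟨r, u, v, huv, hvu⟩ := hf
  refine ⟨r, a * u, v * b, ?_, ?_⟩
  · rw [Matrix.mul_assoc, ← Matrix.mul_assoc u, huv, ← he]
    simp only [Matrix.mul_assoc]
  · calc v * b * (a * u) = v * (b * a) * u := by simp only [Matrix.mul_assoc]
      _ = (v * u) * (v * u) := by rw [← huv]; simp only [Matrix.mul_assoc]
      _ = 1 := by rw [hvu, Matrix.one_mul]

/-- The substitution `p(X) ↦ p(X + cY)`. -/
noncomputable def shiftHom {R : Type*} [CommRing R] (c : R) : R[X] →+* R[X][X] :=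
  eval₂RingHom (C.comp C) (C X + C (C c) * X)

/-- The substitution `p(X, Y) ↦ p(X, cY)`. -/
noncomputable def scaleHom {R : Type*} [CommRing R] (c : R) : R[X][X] →+* R[X][X] :=
  eval₂RingHom C (C (C c) * X)

theorem scaleHom_comp_shiftHom {R : Type*} [CommRing R] (c d : R) :
    (scaleHom c).comp (shiftHom d) = shiftHom (c * d) := by
  refine Polynomial.ringHom_ext (fun a => ?_) ?_
  · simp [scaleHom, shiftHom]
  · simp [scaleHom, shiftHom]
    ring

theorem map_comp_shiftHom {R S : Type*} [CommRing R] [CommRing S] (ι : R →+* S) (c : R) :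
    (mapRingHom (mapRingHom ι)).comp (shiftHom c) = (shiftHom (ι c)).comp (mapRingHom ι) := by
  refine Polynomial.ringHom_ext (fun a => ?_) ?_
  · simp [shiftHom]
  · simp [shiftHom]

theorem map_comp_scaleHom {R S : Type*} [CommRing R] [CommRing S] (ι : R →+* S) (c : R) :
    (mapRingHom (mapRingHom ι)).comp (scaleHom c) =
      (scaleHom (ι c)).comp (mapRingHom (mapRingHom ι)) := by
  refine Polynomial.ringHom_ext (fun a => ?_) ?_
  · simp [scaleHom]
  · simp [scaleHom]

theorem exists_scaleHom_mem_range {R S : Type*} [CommRing R] [CommRing S] [Algebra R S]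
    (M : Submonoid R) [IsLocalization M S] {κ : Type*} [Finite κ] (p : κ → S[X][X])
    (hp : ∀ i, (p i).coeff 0 ∈ (mapRingHom (algebraMap R S)).range) :
    ∃ c ∈ M, ∀ i, scaleHom (algebraMap R S c) (p i) ∈
      (mapRingHom (mapRingHom (algebraMap R S))).range := by
  let _ : Algebra R[X] S[X] := Polynomial.algebra R S
  have : IsLocalization (M.map C) S[X] := Polynomial.isLocalization M S
  let _ : Algebra R[X][X] S[X][X] := Polynomial.algebra R[X] S[X]
  have : IsLocalization ((M.map C).map C) S[X][X] := Polynomial.isLocalization (M.map C) S[X]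
  obtain ⟨⟨_, _, ⟨c, hc, rfl⟩, rfl⟩, h⟩ := IsLocalization.exist_integer_multiples_of_finite
    ((M.map C).map C) (fun i => (p i).divX)
  refine ⟨c, hc, fun i => ?_⟩
  obtain ⟨y, hy⟩ := h i
  obtain ⟨y₀, hy₀⟩ := hp i
  have hy' : mapRingHom (mapRingHom (algebraMap R S)) y =
      C (C (algebraMap R S c)) * (p i).divX := by
    rw [Algebra.smul_def] at hy
    refine Eq.trans hy ?_
    congr 1
    change mapRingHom (mapRingHom (algebraMap R S)) (C (C c)) = _
    simp
  refine ⟨scaleHom c y * X + C y₀, ?_⟩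
  rw [map_add, map_mul, ← RingHom.comp_apply, map_comp_scaleHom, RingHom.comp_apply, hy']
  conv_rhs => rw [← divX_mul_X_add (p i)]
  rw [← hy₀]
  simp [scaleHom]
  ring

theorem exists_idemEquiv_shiftHom {R S : Type*} [CommRing R] [CommRing S] [Algebra R S]
    (M : Submonoid R) [IsLocalization M S] (hinj : Function.Injective (algebraMap R S)) {N : ℕ}
    {e : Matrix (Fin N) (Fin N) R[X]}
    (h : IsFreeIdem (e.map (mapRingHom (algebraMap R S)))) :
    ∃ c ∈ M, IdemEquiv (e.map (shiftHom c)) (e.map (shiftHom 0)) := by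
  let ι := algebraMap R S
  obtain ⟨r, u, v, huv, hvu⟩ := h
  let w := u.map (shiftHom 1) * v.map (shiftHom 0)
  let z := u.map (shiftHom 0) * v.map (shiftHom 1)
  have h0 : ∀ (c : S) (p : S[X]), (shiftHom c p).coeff 0 = p := by
    intro c p
    rw [coeff_zero_eq_eval_zero]
    have : (evalRingHom (0 : S[X])).comp (shiftHom c) = RingHom.id _ := by
      refine Polynomial.ringHom_ext (fun a => ?_) ?_ <;> simp [shiftHom]
    exact RingHom.congr_fun this p
  have hw0 : ∀ (c d : S) (i j),
      ((u.map (shiftHom c) * v.map (shiftHom d)) i j).coeff 0 = mapRingHom ι (e i j) := by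
    intro c d i j
    have : mapRingHom ι (e i j) = (u * v) i j := by rw [huv]; rfl
    rw [this, coeff_zero_eq_eval_zero, ← coe_evalRingHom, Matrix.mul_apply, map_sum,
      Matrix.mul_apply]
    refine Finset.sum_congr rfl fun k _ => ?_
    rw [map_mul, Matrix.map_apply, Matrix.map_apply, coe_evalRingHom, ← coeff_zero_eq_eval_zero,
      ← coeff_zero_eq_eval_zero, h0, h0]
  have hwz : w * z = (u * v).map (shiftHom 1) := by
    calc w * z = u.map (shiftHom 1) * (v * u).map (shiftHom 0) * v.map (shiftHom 1) := by
          rw [Matrix.map_mul]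
          simp only [w, z, Matrix.mul_assoc]
      _ = _ := by rw [hvu, Matrix.map_one _ (map_zero _) (map_one _), Matrix.mul_one,
          Matrix.map_mul]
  have hzw : z * w = (u * v).map (shiftHom 0) := by
    calc z * w = u.map (shiftHom 0) * (v * u).map (shiftHom 1) * v.map (shiftHom 0) := by
          rw [Matrix.map_mul]
          simp only [w, z, Matrix.mul_assoc]
      _ = _ := by rw [hvu, Matrix.map_one _ (map_zero _) (map_one _), Matrix.mul_one,
          Matrix.map_mul]
  obtain ⟨c, hc, hcr⟩ := exists_scaleHom_mem_range (S := S) M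
    (Sum.elim (fun p : Fin N × Fin N => w p.1 p.2) (fun p : Fin N × Fin N => z p.1 p.2))
    (by
      rintro (⟨i, j⟩ | ⟨i, j⟩)
      · exact ⟨e i j, (hw0 1 0 i j).symm⟩
      · exact ⟨e i j, (hw0 0 1 i j).symm⟩)
  choose w' hw' using fun i j => hcr (Sum.inl (i, j))
  choose z' hz' using fun i j => hcr (Sum.inr (i, j))
  let Φ := mapRingHom (mapRingHom ι)
  have hΦ : Function.Injective Φ := Polynomial.map_injective _ (Polynomial.map_injective _ hinj)
  have hW : (Matrix.of w').map Φ = w.map (scaleHom (ι c)) := Matrix.ext hw'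
  have hZ : (Matrix.of z').map Φ = z.map (scaleHom (ι c)) := Matrix.ext hz'
  have hshift : ∀ d : R, ((u * v).map (shiftHom (ι d))).map (scaleHom (ι c)) =
      (e.map (shiftHom (c * d))).map Φ := by
    intro d
    rw [huv]
    ext1 i j
    have h1 := RingHom.congr_fun (scaleHom_comp_shiftHom (ι c) (ι d)) (mapRingHom ι (e i j))
    have h2 := RingHom.congr_fun (map_comp_shiftHom ι (c * d)) (e i j)
    rw [map_mul] at h2
    exact h1.trans h2.symm
  refine ⟨c, hc, Matrix.of w', Matrix.of z', ?_, ?_⟩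
  · apply Matrix.map_injective hΦ
    beta_reduce
    have := hshift 1
    rw [map_one, mul_one] at this
    rw [← this, Matrix.map_mul, hW, hZ, ← Matrix.map_mul, hwz]
  · apply Matrix.map_injective hΦ
    beta_reduce
    have := hshift 0
    rw [map_zero, mul_zero] at this
    rw [← this, Matrix.map_mul, hW, hZ, ← Matrix.map_mul, hzw]

/-- The ideal of those `c` for which `e(X + cY)` and `e(X)` are equivalent. -/
noncomputable def quillenIdeal {R : Type*} [CommRing R] {N : ℕ} {e : Matrix (Fin N) (Fin N) R[X]}
    (he : e * e = e) : Ideal R where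
  carrier := {c | IdemEquiv (e.map (shiftHom c)) (e.map (shiftHom 0))}
  zero_mem' := ⟨e.map (shiftHom 0), e.map (shiftHom 0), by rw [← Matrix.map_mul, he],
    by rw [← Matrix.map_mul, he]⟩
  add_mem' := by
    intro c d hc hd
    have hid : ∀ φ : R[X] →+* R[X][X], e.map φ * e.map φ = e.map φ := fun φ => by
      rw [← Matrix.map_mul, he]
    refine IdemEquiv.trans (hid _) (hid _) ?_ hd
    let σ : R[X][X] →+* R[X][X] := eval₂RingHom (shiftHom d) X
    have hσ : ∀ c, σ.comp (shiftHom c) = shiftHom (c + d) := by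
      intro c
      refine Polynomial.ringHom_ext (fun a => ?_) ?_
      · simp [σ, shiftHom]
      · simp [σ, shiftHom]
        ring
    have h1 := IdemEquiv.map hc σ
    rwa [Matrix.map_map, Matrix.map_map, ← RingHom.coe_comp, ← RingHom.coe_comp, hσ, hσ,
      zero_add] at h1
  smul_mem' := by
    intro a c hc
    have h1 := IdemEquiv.map hc (scaleHom a)
    rwa [Matrix.map_map, Matrix.map_map, ← RingHom.coe_comp, ← RingHom.coe_comp,
      scaleHom_comp_shiftHom, scaleHom_comp_shiftHom, mul_zero] at h1

/-- **Quillen patching** for idempotent matrices over a domain. -/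
theorem isFreeIdem_of_localization_maximal {R : Type*} [CommRing R] [IsDomain R]
    (hR : IdemFree R) {N : ℕ} {e : Matrix (Fin N) (Fin N) R[X]} (he : e * e = e)
    (h : ∀ (m : Ideal R) [m.IsMaximal],
      IsFreeIdem (e.map (mapRingHom (algebraMap R (Localization.AtPrime m))))) :
    IsFreeIdem e := by
  have htop : quillenIdeal he = ⊤ := by
    by_contra hne
    obtain ⟨m, hm, hle⟩ := Ideal.exists_le_maximal _ hne
    obtain ⟨c, hc, hce⟩ := exists_idemEquiv_shiftHom m.primeCompl
      (IsLocalization.injective (Localization.AtPrime m) m.primeCompl_le_nonZeroDivisors) (h m)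
    exact hc (hle hce)
  have h1 : IdemEquiv (e.map (shiftHom 1)) (e.map (shiftHom 0)) :=
    (Ideal.eq_top_iff_one _).mp htop
  let τ : R[X][X] →+* R[X] := eval₂RingHom (C.comp (evalRingHom 0)) X
  have hτ1 : τ.comp (shiftHom 1) = RingHom.id _ := by
    refine Polynomial.ringHom_ext (fun a => ?_) ?_ <;> simp [τ, shiftHom]
  have hτ0 : τ.comp (shiftHom 0) = C.comp (evalRingHom 0) := by
    refine Polynomial.ringHom_ext (fun a => ?_) ?_ <;> simp [τ, shiftHom]
  have h2 := h1.map τ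
  rw [Matrix.map_map, Matrix.map_map, ← RingHom.coe_comp, ← RingHom.coe_comp, hτ1, hτ0,
    RingHom.coe_comp, ← Matrix.map_map, RingHom.coe_id, Matrix.map_id] at h2
  refine h2.isFreeIdem he (IsFreeIdem.map (hR _ _ ?_) C)
  rw [← Matrix.map_mul, he]

end Patching

section QuillenSuslin

/-- Functoriality of `A⟨X⟩`. -/
noncomputable def MonicLoc.map {A B : Type*} [CommRing A] [CommRing B] (φ : A →+* B) :
    MonicLoc A →+* MonicLoc B :=
  IsLocalization.map (M := monicSubmonoid A) (T := monicSubmonoid B) (MonicLoc B) (mapRingHom φ)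
    (fun _ hf => (mem_monicSubmonoid.mp hf).map φ)

theorem MonicLoc.map_algebraMap {A B : Type*} [CommRing A] [CommRing B] (φ : A →+* B) (a : A[X]) :
    MonicLoc.map φ (algebraMap A[X] (MonicLoc A) a) = algebraMap B[X] (MonicLoc B) (a.map φ) :=
  IsLocalization.map_eq _ a

/-- Descent of freeness from the localization at monic polynomials. -/
theorem isFreeIdem_of_monicLoc {R : Type*} [CommRing R] [IsDomain R] (hR : IdemFree R) {N : ℕ}
    {e : Matrix (Fin N) (Fin N) R[X]} (he : e * e = e)
    (h : IsFreeIdem (e.map (algebraMap R[X] (MonicLoc R)))) : IsFreeIdem e := by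
  refine isFreeIdem_of_localization_maximal hR he fun m hm => ?_
  have : IsDomain (Localization.AtPrime m) :=
    IsLocalization.isDomain_localization m.primeCompl_le_nonZeroDivisors
  refine isFreeIdem_of_isFreeIdem_monicLoc (by rw [← Matrix.map_mul, he]) ?_
  have h1 := h.map (MonicLoc.map (algebraMap R (Localization.AtPrime m)))
  rw [Matrix.map_map] at h1 ⊢
  convert h1 using 1
  ext1 i j
  exact (MonicLoc.map_algebraMap _ _).symm

/-- The **Quillen–Suslin theorem** over a principal ideal domain. -/
theorem idemFree_mvPolynomial (n : ℕ) : ∀ (B : Type*) [CommRing B] [IsDomain B]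
    [IsPrincipalIdealRing B], IdemFree (MvPolynomial (Fin n) B) := by
  induction n with
  | zero =>
    intro B _ _ _
    exact (idemFree_of_isPrincipalIdealRing B).of_ringEquiv
      (MvPolynomial.isEmptyRingEquiv B (Fin 0))
  | succ n ih =>
    intro B _ _ _
    refine IdemFree.of_ringEquiv (MvPolynomial.finSuccEquiv B n).toRingEquiv ?_
    intro N e he
    refine isFreeIdem_of_monicLoc (ih B) he ?_
    have := isPrincipalIdealRing_monicLoc B
    let α : (MvPolynomial (Fin n) B)[X] →+* MvPolynomial (Fin n) (MonicLoc B) :=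
      eval₂RingHom (MvPolynomial.map ((algebraMap B[X] (MonicLoc B)).comp C))
        (MvPolynomial.C (algebraMap B[X] (MonicLoc B) X))
    let β : MvPolynomial (Fin n) (MonicLoc B) →+* MonicLoc (MvPolynomial (Fin n) B) :=
      MvPolynomial.eval₂Hom (MonicLoc.map MvPolynomial.C)
        (fun i => algebraMap (MvPolynomial (Fin n) B)[X] (MonicLoc (MvPolynomial (Fin n) B))
          (C (MvPolynomial.X i)))
    have hβα : β.comp α = algebraMap _ (MonicLoc (MvPolynomial (Fin n) B)) := by
      refine Polynomial.ringHom_ext' ?_ ?_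
      · refine MvPolynomial.ringHom_ext (fun a => ?_) (fun i => ?_)
        · simp [α, β, MonicLoc.map_algebraMap]
        · simp [α, β]
      · simp [α, β, MonicLoc.map_algebraMap]
    have h1 := (ih (MonicLoc B) N (e.map α) (by rw [← Matrix.map_mul, he])).map β
    rwa [Matrix.map_map, ← RingHom.coe_comp, hβα] at h1

end QuillenSuslin

section TorsionFreeModule

open scoped Pointwise

theorem IsLocalization.isPrincipalIdealRing_of_isPrincipalIdealRing {R : Type*} [CommRing R]
    [IsPrincipalIdealRing R] (S : Submonoid R) (A : Type*) [CommRing A] [Algebra R A]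
    [IsLocalization S A] : IsPrincipalIdealRing A where
  principal I := by
    obtain ⟨g, hg⟩ := (IsPrincipalIdealRing.principal (I.comap (algebraMap R A))).principal
    rw [← IsLocalization.map_under S A I, Ideal.under, hg, Ideal.submodule_span_eq,
      Ideal.map_span, Set.image_singleton]
    exact ⟨⟨_, rfl⟩⟩

/-- Lifting a basis of `M / tM` to `M`. -/
theorem exists_linearMap_of_free_quotient {R M : Type*} [CommRing R] [AddCommGroup M] [Module R M]
    {t : R} [Nontrivial (R ⧸ Ideal.span {t})] {r : ℕ}
    (hfree : Module.Free (R ⧸ Ideal.span {t}) (M ⧸ t • (⊤ : Submodule R M)))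
    (hrank : Module.rank (R ⧸ Ideal.span {t}) (M ⧸ t • (⊤ : Submodule R M)) = r) :
    ∃ β : (Fin r → R) →ₗ[R] M, (∀ x, ∃ v y, x = β v + t • y) ∧
      ∀ v y, β v = t • y → ∃ w, v = t • w := by
  let π := (t • (⊤ : Submodule R M)).mkQ
  have hπ : ∀ x, π x = 0 ↔ ∃ y, x = t • y := fun x => by
    rw [Submodule.mkQ_apply, Submodule.Quotient.mk_eq_zero, Submodule.mem_smul_pointwise_iff_exists]
    simp [eq_comm]
  have hfin : Module.Finite (R ⧸ Ideal.span {t}) (M ⧸ t • (⊤ : Submodule R M)) :=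
    Module.rank_lt_aleph0_iff.mp (hrank ▸ Cardinal.natCast_lt_aleph0)
  let b := Module.finBasisOfFinrankEq _ _ (Module.finrank_eq_of_rank_eq hrank)
  choose m hm using fun i => Submodule.mkQ_surjective _ (b i)
  have hβ : ∀ v : Fin r → R, π (Fintype.linearCombination R m v) =
      ∑ i, Ideal.Quotient.mk (Ideal.span {t}) (v i) • b i := fun v => by
    rw [Fintype.linearCombination_apply, map_sum]
    refine Finset.sum_congr rfl fun i _ => ?_
    rw [← hm]
    rfl
  refine ⟨Fintype.linearCombination R m, fun x => ?_, fun v y h => ?_⟩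
  · choose v hv using fun i => Ideal.Quotient.mk_surjective (b.repr (π x) i)
    obtain ⟨y, hy⟩ := (hπ (x - Fintype.linearCombination R m v)).mp (by
      rw [map_sub, hβ, sub_eq_zero]
      simp only [hv, b.sum_repr])
    exact ⟨v, y, by rw [← hy]; abel⟩
  · have h0 := (hβ v).symm.trans ((hπ _).mpr ⟨y, h⟩)
    have h1 := Fintype.linearIndependent_iff.mp b.linearIndependent _ h0
    choose w hw using fun i =>
      Ideal.mem_span_singleton.mp (Ideal.Quotient.eq_zero_iff_mem.mp (h1 i))
    exact ⟨w, funext hw⟩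

/-- Clearing denominators in a basis of `M[1/t]`. -/
theorem exists_linearMap_of_free_localization {R M : Type*} [CommRing R] [IsDomain R]
    [AddCommGroup M] [Module R M] {t : R} (ht : t ≠ 0)
    (htf : ∀ (a : R) (x : M), a • x = 0 → a = 0 ∨ x = 0) {r : ℕ}
    (Rt : Type*) [CommRing Rt] [Algebra R Rt] [IsLocalization (Submonoid.powers t) Rt]
    (Mt : Type*) [AddCommGroup Mt] [Module R Mt] [Module Rt Mt] [IsScalarTower R Rt Mt]
    (f : M →ₗ[R] Mt) [IsLocalizedModule (Submonoid.powers t) f]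
    (hfree : Module.Free Rt Mt) (hrank : Module.rank Rt Mt = r) :
    ∃ β : (Fin r → R) →ₗ[R] M, Function.Injective β ∧ ∀ x, ∃ k v, t ^ k • x = β v := by
  have hp : Submonoid.powers t ≤ nonZeroDivisors R := powers_le_nonZeroDivisors_of_noZeroDivisors ht
  have hinj : Function.Injective (algebraMap R Rt) := IsLocalization.injective Rt hp
  have : Nontrivial Rt := hinj.nontrivial
  have hf : Function.Injective f := by
    refine (injective_iff_map_eq_zero f).mpr fun x hx => ?_
    obtain ⟨⟨_, k, rfl⟩, hc⟩ := (IsLocalizedModule.eq_zero_iff (Submonoid.powers t) f).mp hx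
    exact (htf _ _ hc).resolve_left (pow_ne_zero k ht)
  have hfin : Module.Finite Rt Mt :=
    Module.rank_lt_aleph0_iff.mp (hrank ▸ Cardinal.natCast_lt_aleph0)
  let b := Module.finBasisOfFinrankEq _ _ (Module.finrank_eq_of_rank_eq hrank)
  obtain ⟨⟨_, k, rfl⟩, hb⟩ :=
    IsLocalizedModule.exist_integer_multiples_of_finite (Submonoid.powers t) f b
  choose m hm using hb
  have hβ : ∀ v : Fin r → R, f (Fintype.linearCombination R m v) =
      ∑ i, (algebraMap R Rt (v i * t ^ k)) • b i := fun v => by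
    rw [Fintype.linearCombination_apply, map_sum]
    refine Finset.sum_congr rfl fun i _ => ?_
    rw [map_smul, hm, algebraMap_smul, mul_smul]
  refine ⟨Fintype.linearCombination R m, ?_, fun x => ?_⟩
  · refine (injective_iff_map_eq_zero _).mpr fun v hv => ?_
    have h0 := (hβ v).symm.trans (by rw [hv, map_zero])
    funext i
    have h1 := Fintype.linearIndependent_iff.mp b.linearIndependent _ h0 i
    rw [map_eq_zero_iff _ hinj] at h1
    exact (mul_eq_zero.mp h1).resolve_right (pow_ne_zero k ht)
  · obtain ⟨⟨_, l, rfl⟩, hl⟩ := IsLocalization.exist_integer_multiples_of_finite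
      (Submonoid.powers t) (fun i => b.repr (f x) i)
    choose v hv using hl
    refine ⟨k + l, v, hf ?_⟩
    rw [hβ, map_smul, ← b.sum_repr (f x), Finset.smul_sum]
    refine Finset.sum_congr rfl fun i _ => ?_
    rw [map_mul, hv, pow_add, mul_smul, ← smul_assoc (t ^ l), ← algebraMap_smul Rt (t ^ k),
      smul_smul, mul_comm]

theorem exists_lift_smul_id {R M : Type*} [CommRing R] [AddCommGroup M] [Module R M] {r : ℕ}
    {β : (Fin r → R) →ₗ[R] M} (hβ : Function.Injective β) {s : R}
    (hs : ∀ x, s • x ∈ LinearMap.range β) :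
    ∃ α : M →ₗ[R] (Fin r → R), ∀ x, β (α x) = s • x := by
  let α : M →ₗ[R] (Fin r → R) := (LinearEquiv.ofInjective β hβ).symm.toLinearMap ∘ₗ
    LinearMap.codRestrict (LinearMap.range β) (LinearMap.lsmul R M s) hs
  refine ⟨α, fun x => ?_⟩
  have := (LinearEquiv.ofInjective β hβ).apply_symm_apply ⟨s • x, hs x⟩
  exact congrArg Subtype.val this

theorem exists_pow_smul_mem_of_finite {R M : Type*} [CommRing R] [AddCommGroup M] [Module R M]
    [Module.Finite R M] {t : R} {N : Submodule R M} (h : ∀ x, ∃ k : ℕ, t ^ k • x ∈ N) :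
    ∃ k : ℕ, ∀ x, t ^ k • x ∈ N := by
  obtain ⟨m, x, hx⟩ := Module.Finite.exists_fin (R := R) (M := M)
  choose k hk using fun i => h (x i)
  refine ⟨∑ i, k i, fun y => ?_⟩
  have hle : (⊤ : Submodule R M) ≤ N.comap (LinearMap.lsmul R M (t ^ ∑ i, k i)) := by
    rw [← hx, Submodule.span_le]
    rintro _ ⟨i, rfl⟩
    change t ^ (∑ i, k i) • x i ∈ N
    rw [← Finset.sum_erase_add _ _ (Finset.mem_univ i), pow_add, mul_smul]
    exact N.smul_mem _ (hk i)
  exact hle Submodule.mem_top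

/-- A torsion-free module over a Noetherian domain which is free both modulo a prime element `t` and
after inverting `t`, of the same finite rank, is free if finitely generated projective modules
are. -/
theorem exists_linearEquiv_of_free_quotient_of_free_localization {R M : Type*} [CommRing R]
    [IsDomain R] [IsNoetherianRing R] (hR : IdemFree R) [AddCommGroup M] [Module R M] {t : R}
    (ht : Prime t) (htf : ∀ (a : R) (x : M), a • x = 0 → a = 0 ∨ x = 0) {r : ℕ}
    {β β' : (Fin r → R) →ₗ[R] M} (h1 : ∀ x, ∃ v y, x = β v + t • y)
    (h2 : ∀ v y, β v = t • y → ∃ w, v = t • w) (hβ' : Function.Injective β')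
    (h3 : ∀ x, ∃ k v, t ^ k • x = β' v) (hrank : Module.rank R M = r) :
    ∃ r' : ℕ, Nonempty (M ≃ₗ[R] (Fin r' → R)) := by
  have hcancel : ∀ x y : M, t • x = t • y → x = y := fun x y h =>
    sub_eq_zero.mp ((htf t (x - y) (by rw [smul_sub, h, sub_self])).resolve_left ht.ne_zero)
  have hβ : Function.Injective β := by
    refine (injective_iff_map_eq_zero β).mpr fun v hv => ?_
    have hdvd : ∀ k : ℕ, ∀ v, β v = 0 → ∀ i, t ^ k ∣ v i := by
      intro k
      induction k with
      | zero => simp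
      | succ k ih =>
        intro v hv i
        obtain ⟨w, rfl⟩ := h2 v 0 (by rw [hv, smul_zero])
        rw [map_smul] at hv
        rw [pow_succ', Pi.smul_apply, smul_eq_mul]
        exact mul_dvd_mul_left t (ih w ((htf _ _ hv).resolve_left ht.ne_zero) i)
    funext i
    by_contra hne
    obtain ⟨k, hk⟩ := FiniteMultiplicity.of_prime_left ht hne
    exact hk (hdvd _ v hv i)
  have hquot : Module.rank R (M ⧸ LinearMap.range β) = 0 := by
    have hq := rank_quotient_add_rank_of_isDomain (LinearMap.range β)
    have hr : Module.rank R (LinearMap.range β) = r := by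
      have := (LinearEquiv.ofInjective β hβ).lift_rank_eq
      simpa using this.symm
    rw [hr, hrank] at hq
    exact Cardinal.eq_of_add_eq_add_right (hq.trans (zero_add _).symm) Cardinal.natCast_lt_aleph0
  have htors : ∀ x : M, ∃ a : R, a ≠ 0 ∧ a • x ∈ LinearMap.range β := fun x => by
    obtain ⟨a, ha, hax⟩ := rank_eq_zero_iff.mp hquot (Submodule.Quotient.mk x)
    exact ⟨a, ha, (Submodule.Quotient.mk_eq_zero _).mp hax⟩
  have hdescend : ∀ (k : ℕ) (x : M), t ^ k • x ∈ LinearMap.range β → x ∈ LinearMap.range β := by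
    intro k
    induction k with
    | zero => simp
    | succ k ih =>
      rintro x ⟨v, hv⟩
      rw [pow_succ', mul_smul] at hv
      obtain ⟨w, rfl⟩ := h2 _ _ hv
      rw [map_smul] at hv
      exact ih x ⟨w, hcancel _ _ hv⟩
  choose a ha hax using fun i => htors (β' (Pi.single i 1))
  have ha0 : ∏ i, a i ≠ 0 := Finset.prod_ne_zero_iff.mpr fun i _ => ha i
  have hprod : ∀ v, (∏ i, a i) • β' v ∈ LinearMap.range β := by
    intro v
    rw [pi_eq_sum_univ' v, map_sum, Finset.smul_sum]
    refine Submodule.sum_mem _ fun i _ => ?_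
    rw [map_smul, smul_comm]
    refine Submodule.smul_mem _ _ ?_
    rw [← Finset.prod_erase_mul _ _ (Finset.mem_univ i), mul_smul]
    exact Submodule.smul_mem _ _ (hax i)
  have hmem : ∀ x, (∏ i, a i) • x ∈ LinearMap.range β := by
    intro x
    obtain ⟨k, v, hv⟩ := h3 x
    refine hdescend k _ ?_
    rw [smul_comm, hv]
    exact hprod v
  have hfin : Module.Finite R M := by
    obtain ⟨α, hα⟩ := exists_lift_smul_id hβ hmem
    refine Module.Finite.of_injective α ((injective_iff_map_eq_zero α).mpr fun x hx => ?_)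
    have := hα x
    rw [hx, map_zero] at this
    exact (htf _ _ this.symm).resolve_left ha0
  obtain ⟨s, hs, hsx⟩ := Submodule.exists_sub_one_mem_and_smul_eq_zero_of_fg_of_le_smul
    (Ideal.span {t}) (⊤ : Submodule R (M ⧸ LinearMap.range β)) Module.Finite.fg_top (by
      intro q _
      obtain ⟨x, rfl⟩ := Submodule.Quotient.mk_surjective _ q
      obtain ⟨v, y, rfl⟩ := h1 x
      rw [Submodule.Quotient.mk_add,
        (Submodule.Quotient.mk_eq_zero (LinearMap.range β)).mpr ⟨v, rfl⟩, zero_add,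
        Submodule.Quotient.mk_smul]
      exact Submodule.smul_mem_smul (Ideal.mem_span_singleton_self t) trivial)
  obtain ⟨α, hα⟩ := exists_lift_smul_id (s := s) hβ fun x =>
    (Submodule.Quotient.mk_eq_zero _).mp (hsx (Submodule.Quotient.mk x) trivial)
  obtain ⟨k, hk⟩ := exists_pow_smul_mem_of_finite (N := LinearMap.range β') (t := t) fun x => by
    obtain ⟨k, v, hv⟩ := h3 x
    exact ⟨k, v, hv.symm⟩
  obtain ⟨α', hα'⟩ := exists_lift_smul_id hβ' hk
  have hcop : IsCoprime s (t ^ k) := by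
    refine IsCoprime.pow_right ?_
    obtain ⟨c, hc⟩ := Ideal.mem_span_singleton.mp hs
    exact ⟨1, -c, by linear_combination hc⟩
  obtain ⟨p, q, hpq⟩ := hcop
  let e : ((Fin r → R) × (Fin r → R)) ≃ₗ[R] (Fin (r + r) → R) :=
    (LinearEquiv.sumArrowLequivProdArrow (Fin r) (Fin r) R R).symm.trans
      (LinearEquiv.funCongrLeft R R finSumFinEquiv.symm)
  refine hR.exists_linearEquiv ((p • β).coprod (q • β') ∘ₗ e.symm.toLinearMap)
    (e.toLinearMap ∘ₗ α.prod α') ?_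
  ext x
  rw [LinearMap.comp_assoc, ← LinearMap.comp_assoc _ _ e.symm.toLinearMap, LinearEquiv.symm_comp,
    LinearMap.id_comp, LinearMap.coprod_comp_prod, LinearMap.add_apply, LinearMap.comp_apply,
    LinearMap.comp_apply, LinearMap.smul_apply, LinearMap.smul_apply, hα, hα', smul_smul, smul_smul,
    ← add_smul, hpq, one_smul, LinearMap.id_apply]

end TorsionFreeModule

end ProjectiveFreeness

section RingRR

instance : IsDomain Rtwo :=
  IsLocalization.isDomain_localization (Ideal.primeCompl_le_nonZeroDivisors _)

instance : IsPrincipalIdealRing Rtwo :=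
  IsLocalization.isPrincipalIdealRing_of_isPrincipalIdealRing
    (Ideal.span {(Polynomial.X : Polynomial ℂ)}).primeCompl
    (Localization (Ideal.span {(Polynomial.X : Polynomial ℂ)}).primeCompl)

theorem prime_algebraMap_X_Rtwo : Prime (algebraMap (Polynomial ℂ) Rtwo Polynomial.X) := by
  have hinj : Function.Injective (algebraMap (Polynomial ℂ) Rtwo) :=
    IsLocalization.injective (Localization (Ideal.span {(Polynomial.X : Polynomial ℂ)}).primeCompl)
      (Ideal.primeCompl_le_nonZeroDivisors (Ideal.span {(Polynomial.X : Polynomial ℂ)}))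
  have hne := (map_ne_zero_iff _ hinj).mpr (Polynomial.X_ne_zero (R := ℂ))
  rw [← Ideal.span_singleton_prime hne]
  have h := Localization.AtPrime.map_eq_maximalIdeal
    (I := Ideal.span {(Polynomial.X : Polynomial ℂ)})
  rw [Ideal.map_span, Set.image_singleton] at h
  change (Ideal.span {algebraMap (Polynomial ℂ)
    (Localization (Ideal.span {(Polynomial.X : Polynomial ℂ)}).primeCompl) Polynomial.X}).IsPrime
  rw [h]
  exact (IsLocalRing.maximalIdeal.isMaximal _).isPrime

/-- `R` as a polynomial ring over `R₂`. -/
noncomputable def rrEquiv (n : ℕ) : RR n ≃+* MvPolynomial (Fin n) Rtwo :=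
  ((Algebra.TensorProduct.comm ℂ (MvPolynomial (Fin n) ℂ) Rtwo).toRingEquiv).trans
    (MvPolynomial.algebraTensorAlgEquiv ℂ Rtwo).toRingEquiv

theorem rrEquiv_tt (n : ℕ) :
    rrEquiv n (tt n) = MvPolynomial.C (algebraMap (Polynomial ℂ) Rtwo Polynomial.X) := by
  refine (MvPolynomial.algebraTensorAlgEquiv_tmul ℂ Rtwo _ _).trans ?_
  rw [map_one, MvPolynomial.smul_eq_C_mul, mul_one]

end RingRR

/-- Proposition A4: a torsion-free `R`-module `M` such that `M/TM` is free of rank `r`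
over `R/TR` and `M[T⁻¹]` is free of rank `r` over `R₁ ⊗ ℂ(T) = R[T⁻¹]` is a free
`R`-module of rank `r`. -/
theorem stmt_2 (n : ℕ) (r : ℕ)
    (M : Type*) [AddCommGroup M] [Module (RR n) M]
    (htf : ∀ (a : RR n) (x : M), a • x = 0 → a = 0 ∨ x = 0)  -- `M` is torsion-free
    (h2 : Module.Free ((RR n) ⧸ Ideal.span {tt n})
      (M ⧸ (tt n) • (⊤ : Submodule (RR n) M)))
    (h2r : Module.rank ((RR n) ⧸ Ideal.span {tt n})
      (M ⧸ (tt n) • (⊤ : Submodule (RR n) M)) = r)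
    -- `Rt` is the localization `R[T⁻¹] = R₁ ⊗ ℂ(T)`, `Mt` the localized module `M[T⁻¹]`
    (Rt : Type*) [CommRing Rt] [Algebra (RR n) Rt]
    [IsLocalization (Submonoid.powers (tt n)) Rt]
    (Mt : Type*) [AddCommGroup Mt] [Module (RR n) Mt] [Module Rt Mt]
    [IsScalarTower (RR n) Rt Mt]
    (f : M →ₗ[RR n] Mt) [IsLocalizedModule (Submonoid.powers (tt n)) f]
    (h1 : Module.Free Rt Mt) (h1r : Module.rank Rt Mt = r) :
    Module.Free (RR n) M ∧ Module.rank (RR n) M = r := by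
  have : IsDomain (RR n) := (rrEquiv n).toMulEquiv.isDomain _
  have : IsNoetherianRing (RR n) := isNoetherianRing_of_ringEquiv _ (rrEquiv n).symm
  have hR : IdemFree (RR n) := (idemFree_mvPolynomial n Rtwo).of_ringEquiv (rrEquiv n)
  have ht : Prime (tt n) := by
    rw [← MulEquiv.prime_iff (rrEquiv n).toMulEquiv]
    exact (rrEquiv_tt n).symm ▸ (MvPolynomial.prime_C_iff (Fin n)).mpr prime_algebraMap_X_Rtwo
  have : Nontrivial (RR n ⧸ Ideal.span {tt n}) :=
    Ideal.Quotient.nontrivial_iff.mpr (by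
      rw [Ne, Ideal.span_singleton_eq_top]
      exact ht.not_isUnit)
  have hp : Submonoid.powers (tt n) ≤ nonZeroDivisors (RR n) :=
    powers_le_nonZeroDivisors_of_noZeroDivisors ht.ne_zero
  have hrank : Module.rank (RR n) M = r := by
    have h := IsLocalizedModule.lift_rank_eq (Submonoid.powers (tt n)) f hp
    rw [← IsLocalization.rank_eq Rt (Submonoid.powers (tt n)) hp, h1r] at h
    simpa using h.symm
  obtain ⟨β, hβ1, hβ2⟩ := exists_linearMap_of_free_quotient h2 h2r
  obtain ⟨β', hβ', hβ'k⟩ := exists_linearMap_of_free_localization ht.ne_zero htf Rt Mt f h1 h1r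
  obtain ⟨r', ⟨e⟩⟩ := exists_linearEquiv_of_free_quotient_of_free_localization hR ht htf
    hβ1 hβ2 hβ' hβ'k hrank
  exact ⟨Module.Free.of_equiv e.symm, hrank⟩
end

section
/- Over a Noetherian ring R localized at a maximal ideal m containing T, a finitely generated torsion-free module M such that M/TM is free and M[T⁻¹] is free of the same rank is free; in particular, any finitely generated projective module over ℂ[X₁,…,Xₙ] ⊗ ℂ[T]_{(T)} is free. -/
open TensorProduct
open scoped Pointwise

section Schanuel

variable {A : Type*} [CommRing A] {Q F M : Type*} [AddCommGroup Q] [AddCommGroup F]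
  [AddCommGroup M] [Module A Q] [Module A F] [Module A M]

/-- The projection from the fibre product of two surjections with projective target splits. -/
theorem nonempty_prod_ker_equiv_ker_coprod [Module.Projective A Q]
    (ρ : Q →ₗ[A] M) (π : F →ₗ[A] M) (hπ : Function.Surjective π) :
    Nonempty ((Q × LinearMap.ker π) ≃ₗ[A] LinearMap.ker (ρ.coprod (-π))) := by
  obtain ⟨s, hs⟩ := Module.projective_lifting_property π ρ hπ
  have hs' : ∀ q, π (s q) = ρ q := fun q => LinearMap.congr_fun hs q
  refine ⟨LinearEquiv.ofLinearMap
    (LinearMap.codRestrict _ (LinearMap.prod (LinearMap.fst A _ _)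
      (s ∘ₗ LinearMap.fst A _ _ + (LinearMap.ker π).subtype ∘ₗ LinearMap.snd A _ _)) ?_)
    (LinearMap.prod (LinearMap.fst A Q F ∘ₗ Submodule.subtype _)
      (LinearMap.codRestrict _ ((LinearMap.snd A Q F - s ∘ₗ LinearMap.fst A Q F) ∘ₗ
        Submodule.subtype _) ?_)) ?_ ?_⟩
  · rintro ⟨q, x, hx⟩
    simp [hs', LinearMap.mem_ker.mp hx]
  · rintro ⟨⟨q, x⟩, hx⟩
    simp only [LinearMap.mem_ker, LinearMap.coprod_apply, LinearMap.neg_apply] at hx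
    simp [hs', ← sub_eq_add_neg] at hx ⊢
    rw [sub_eq_zero] at hx ⊢
    exact hx.symm
  · ext x <;> simp
  · ext x <;> simp

/-- **Schanuel's lemma**. -/
theorem schanuel [Module.Projective A Q] [Module.Projective A F]
    (ρ : Q →ₗ[A] M) (π : F →ₗ[A] M) (hρ : Function.Surjective ρ) (hπ : Function.Surjective π) :
    Nonempty ((Q × LinearMap.ker π) ≃ₗ[A] (F × LinearMap.ker ρ)) := by
  obtain ⟨e₁⟩ := nonempty_prod_ker_equiv_ker_coprod ρ π hπ
  obtain ⟨e₂⟩ := nonempty_prod_ker_equiv_ker_coprod π ρ hρ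
  refine ⟨e₁ ≪≫ₗ LinearEquiv.ofSubmodules (LinearEquiv.prodComm A Q F) _ _ ?_ ≪≫ₗ e₂.symm⟩
  ext ⟨x, q⟩
  simp only [Submodule.mem_map, LinearMap.mem_ker, LinearMap.coprod_apply, LinearMap.neg_apply,
    Prod.exists, LinearEquiv.coe_coe, LinearEquiv.prodComm_apply, Prod.swap_prod_mk, Prod.mk.injEq]
  constructor
  · rintro ⟨a, b, h, rfl, rfl⟩
    rw [← neg_eq_zero, ← h]; abel
  · intro h
    refine ⟨q, x, ?_, rfl, rfl⟩
    rw [← neg_eq_zero, ← h]; abel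

theorem projective_ker_of_projective_ker [Module.Projective A Q] [Module.Projective A F]
    (ρ : Q →ₗ[A] M) (π : F →ₗ[A] M) (hρ : Function.Surjective ρ) (hπ : Function.Surjective π)
    [Module.Projective A (LinearMap.ker ρ)] : Module.Projective A (LinearMap.ker π) := by
  obtain ⟨e⟩ := schanuel ρ π hρ hπ
  exact Module.Projective.of_split (e.toLinearMap ∘ₗ LinearMap.inr A Q _)
    (LinearMap.snd A Q _ ∘ₗ e.symm.toLinearMap) (by ext; simp)

end Schanuel

section CharacteristicSequence

open Polynomial

variable {B : Type*} [CommRing B] {M : Type*} [AddCommGroup M] [Module B M] [Module B[X] M]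
  [IsScalarTower B B[X] M]

/-- The action map `M[X] → M` of a `B[X]`-module `M`. -/
noncomputable def actionMap (B M : Type*) [CommRing B] [AddCommGroup M] [Module B M]
    [Module B[X] M] [IsScalarTower B B[X] M] : B[X] ⊗[B] M →ₗ[B[X]] M :=
  LinearMap.liftBaseChange B[X] LinearMap.id

theorem actionMap_tmul (p : B[X]) (x : M) : actionMap B M (p ⊗ₜ x) = p • x := by
  simp [actionMap]

/-- The difference of the two actions of `X` on `M[X]`. -/
noncomputable def actionDiff (B M : Type*) [CommRing B] [AddCommGroup M] [Module B M]
    [Module B[X] M] [IsScalarTower B B[X] M] : B[X] ⊗[B] M →ₗ[B[X]] B[X] ⊗[B] M :=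
  LinearMap.lsmul B[X] _ X - (LinearMap.baseChange B[X]
    (((LinearMap.lsmul B[X] M X).restrictScalars B)))

theorem actionDiff_tmul (p : B[X]) (x : M) :
    actionDiff B M (p ⊗ₜ x) = (X * p) ⊗ₜ x - p ⊗ₜ ((X : B[X]) • x) := by
  simp [actionDiff, TensorProduct.smul_tmul']

theorem actionMap_surjective : Function.Surjective (actionMap B M) :=
  fun x => ⟨1 ⊗ₜ x, by simp [actionMap_tmul]⟩

theorem sub_one_tmul_actionMap_mem_range (w : B[X] ⊗[B] M) :
    w - 1 ⊗ₜ actionMap B M w ∈ LinearMap.range (actionDiff B M) := by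
  induction w using TensorProduct.induction_on with
  | zero => simp
  | add w₁ w₂ h₁ h₂ =>
    rw [map_add, TensorProduct.tmul_add, add_sub_add_comm]
    exact add_mem h₁ h₂
  | tmul p x =>
    rw [actionMap_tmul]
    induction p using Polynomial.induction_on' generalizing x with
    | add p q hp hq =>
      rw [add_smul, TensorProduct.tmul_add, TensorProduct.add_tmul, add_sub_add_comm]
      exact add_mem (hp x) (hq x)
    | monomial n b =>
      induction n generalizing x with
      | zero =>
        have h : (monomial 0 b : B[X]) = b • (1 : B[X]) := by
          rw [monomial_zero_left, smul_eq_C_mul, mul_one]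
        rw [h, smul_assoc, one_smul, TensorProduct.smul_tmul, sub_self]
        exact zero_mem _
      | succ n ih =>
        have h : (monomial (n + 1) b : B[X]) = X * monomial n b := by
          rw [X_mul_monomial]
        have h2 := add_mem (ih ((X : B[X]) • x)) (LinearMap.mem_range_self (actionDiff B M)
          (monomial n b ⊗ₜ x))
        rw [actionDiff_tmul, ← mul_smul, mul_comm, ← h] at h2
        convert h2 using 1
        abel

theorem range_actionDiff : LinearMap.range (actionDiff B M) = LinearMap.ker (actionMap B M) := by
  apply le_antisymm
  · rintro _ ⟨w, rfl⟩
    induction w using TensorProduct.induction_on with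
    | zero => simp
    | add w₁ w₂ h₁ h₂ => rw [map_add]; exact add_mem h₁ h₂
    | tmul p x =>
      simp [actionDiff_tmul, actionMap_tmul, mul_smul, smul_comm p]
  · intro w hw
    have := sub_one_tmul_actionMap_mem_range w
    rwa [LinearMap.mem_ker.mp hw, TensorProduct.tmul_zero, sub_zero] at this

open PolynomialModule in
theorem actionDiff_injective : Function.Injective (actionDiff B M) := by
  let E := polynomialTensorProductLEquivPolynomialModule B M
  have hE : ∀ (n : ℕ) (b : B) (x : M), E (monomial n b ⊗ₜ x) = PolynomialModule.single B n (b • x) := by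
    intro n b x
    change LinearMap.liftBaseChange B[X] (lsingle B (M := M) 0) (monomial n b ⊗ₜ x) = _
    rw [LinearMap.liftBaseChange_tmul, monomial_smul_lsingle]
    rfl
  have coeff_sub : ∀ (u v : PolynomialModule B M), (u - v).coeff = u.coeff - v.coeff :=
    map_sub (coeffAddEquiv (R := B) (M := M))
  have key : ∀ w (n : ℕ), (E (actionDiff B M w)).coeff (n + 1) =
      (E w).coeff n - (X : B[X]) • (E w).coeff (n + 1) := by
    intro w n
    induction w using TensorProduct.induction_on with
    | zero => simp
    | add w₁ w₂ h₁ h₂ => simp [h₁, h₂]; abel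
    | tmul p x =>
      induction p using Polynomial.induction_on' with
      | add p q hp hq => simp [TensorProduct.add_tmul, hp, hq]; abel
      | monomial m b =>
        rw [actionDiff_tmul, X_mul_monomial, map_sub, hE, hE, hE]
        simp [coeff_sub, Finsupp.single_apply, smul_comm b]
  rw [injective_iff_map_eq_zero]
  intro w hw
  have step : ∀ n, (E w).coeff n = (X : B[X]) • (E w).coeff (n + 1) := by
    intro n
    have := key w n
    rw [hw, map_zero, PolynomialModule.coeff_zero, Finsupp.zero_apply] at this
    exact (sub_eq_zero.mp this.symm)
  have iter : ∀ k n, (E w).coeff n = (X : B[X]) ^ k • (E w).coeff (n + k) := by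
    intro k
    induction k with
    | zero => simp
    | succ k ih => intro n; rw [ih n, step (n + k), pow_succ, mul_smul, add_assoc]
  have : E w = 0 := by
    apply PolynomialModule.coeff_injective
    ext n
    obtain ⟨N, hN⟩ := (E w).coeff.support.exists_nat_subset_range
    have h0 : (E w).coeff (n + N) = 0 := by
      by_contra h
      have := hN (Finsupp.mem_support_iff.mpr h)
      simp at this
    rw [iter N n, h0]; simp
  simpa using this

end CharacteristicSequence

universe u

/-- Every finitely generated projective `A`-module is free. -/
def ProjectivesFree (A : Type u) [CommRing A] : Prop :=
  ∀ (P : Type u) [AddCommGroup P] [Module A P],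
    Module.Finite A P → Module.Projective A P → Module.Free A P

theorem projective_restrictScalars (R S P : Type*) [CommRing R] [CommRing S] [Algebra R S]
    [AddCommGroup P] [Module R P] [Module S P] [IsScalarTower R S P] [Module.Projective R S]
    [Module.Projective S P] : Module.Projective R P := by
  have : Module.Projective R (P →₀ S) := by
    classical exact Module.Projective.of_equiv (finsuppLequivDFinsupp R).symm
  obtain ⟨s, hs⟩ := Module.projective_def'.mp ‹Module.Projective S P›
  exact Module.Projective.of_split (s.restrictScalars R)
    ((Finsupp.linearCombination S id).restrictScalars R)
    (LinearMap.ext fun x => LinearMap.congr_fun hs x)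

section StablyFree

open Polynomial

variable {B : Type*} [CommRing B] {M F P : Type*} [AddCommGroup M] [Module B M] [Module B[X] M]
  [IsScalarTower B B[X] M] [AddCommGroup F] [Module B F]

theorem nonempty_ker_actionMap_comp_baseChange_equiv [Module.Free B F]
    (π : F →ₗ[B] M) (hπ : Function.Surjective π) [Module.Projective B[X]
      (LinearMap.ker (actionMap B M ∘ₗ LinearMap.baseChange B[X] π))] :
    Nonempty ((LinearMap.ker (actionMap B M ∘ₗ LinearMap.baseChange B[X] π) ×
      (B[X] ⊗[B] LinearMap.ker π)) ≃ₗ[B[X]]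
      ((B[X] ⊗[B] F) × (B[X] ⊗[B] LinearMap.ker π))) := by
  set q := LinearMap.baseChange B[X] π with hq
  have hq_surj : Function.Surjective q := LinearMap.lTensor_surjective _ hπ
  set K := LinearMap.ker (actionMap B M ∘ₗ q)
  let e : (B[X] ⊗[B] M) ≃ₗ[B[X]] LinearMap.range (actionDiff B M) :=
    LinearEquiv.ofInjective _ actionDiff_injective
  let g : K →ₗ[B[X]] LinearMap.range (actionDiff B M) :=
    LinearMap.codRestrict _ (q ∘ₗ K.subtype) (by
      rintro ⟨x, hx⟩
      rw [range_actionDiff]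
      exact hx)
  have hg : Function.Surjective g := by
    rintro ⟨y, hy⟩
    obtain ⟨x, rfl⟩ := hq_surj y
    refine ⟨⟨x, ?_⟩, rfl⟩
    rw [range_actionDiff] at hy
    exact hy
  let g' : K →ₗ[B[X]] B[X] ⊗[B] M := e.symm.toLinearMap ∘ₗ g
  have hg' : Function.Surjective g' := e.symm.surjective.comp hg
  obtain ⟨s⟩ := schanuel (A := B[X]) (Q := K) (M := B[X] ⊗[B] M) g' q hg' hq_surj
  have h₁ : LinearMap.ker g' = LinearMap.ker g :=
    LinearEquiv.ker_comp e.symm g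
  have h₂ : (LinearMap.ker g).map K.subtype = LinearMap.ker q := by
    ext x
    constructor
    · rintro ⟨y, hy, rfl⟩
      exact congrArg Subtype.val (LinearMap.mem_ker.mp hy)
    · intro hx
      refine ⟨⟨x, ?_⟩, ?_, rfl⟩
      · simp [K, LinearMap.mem_ker.mp hx]
      · exact Subtype.ext (LinearMap.mem_ker.mp hx)
  let e₁ : LinearMap.ker g' ≃ₗ[B[X]] LinearMap.ker q :=
    LinearEquiv.ofEq _ _ h₁ ≪≫ₗ
      Submodule.equivMapOfInjective K.subtype K.injective_subtype (LinearMap.ker g) ≪≫ₗ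
      LinearEquiv.ofEq _ _ h₂
  let j : B[X] ⊗[B] LinearMap.ker π →ₗ[B[X]] B[X] ⊗[B] F :=
    LinearMap.baseChange B[X] (LinearMap.ker π).subtype
  have hj : Function.Injective j :=
    Module.Flat.lTensor_preserves_injective_linearMap _ (LinearMap.ker π).injective_subtype
  have hjr : LinearMap.range j = LinearMap.ker q :=
    (Module.Flat.ker_lTensor_eq B[X] B[X] π).symm
  let e₂ : (B[X] ⊗[B] LinearMap.ker π) ≃ₗ[B[X]] LinearMap.ker q :=
    LinearEquiv.ofInjective j hj ≪≫ₗ LinearEquiv.ofEq _ _ hjr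
  exact ⟨(LinearEquiv.refl _ _).prodCongr e₂ ≪≫ₗ s ≪≫ₗ
    (LinearEquiv.refl _ _).prodCongr (e₁ ≪≫ₗ e₂.symm)⟩

theorem isStablyFree_of_presentation [AddCommGroup P] [Module B[X] P] [Module.Projective B[X] P]
    (ρ : P →ₗ[B[X]] M) (hρ : Function.Surjective ρ) [Module.Free B[X] (LinearMap.ker ρ)]
    [Module.Free B F] [Module.Finite B F] (π : F →ₗ[B] M) (hπ : Function.Surjective π)
    [Module.Free B (LinearMap.ker π)] [Module.Finite B (LinearMap.ker π)] :
    Module.IsStablyFree B[X] P := by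
  have hp : Function.Surjective (actionMap B M ∘ₗ LinearMap.baseChange B[X] π) :=
    actionMap_surjective.comp (LinearMap.lTensor_surjective _ hπ)
  have := projective_ker_of_projective_ker ρ _ hρ hp
  obtain ⟨s⟩ := schanuel ρ _ hρ hp
  obtain ⟨t⟩ := nonempty_ker_actionMap_comp_baseChange_equiv π hπ
  have : Module.Free B[X] (P × ((B[X] ⊗[B] F) × (B[X] ⊗[B] LinearMap.ker π))) :=
    Module.Free.of_equiv ((LinearEquiv.refl _ P).prodCongr t.symm ≪≫ₗ
      (LinearEquiv.prodAssoc _ _ _ _).symm ≪≫ₗ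
      s.prodCongr (LinearEquiv.refl _ (B[X] ⊗[B] LinearMap.ker π))).symm
  exact Module.IsStablyFree.of_free_prod B[X] P ((B[X] ⊗[B] F) × (B[X] ⊗[B] LinearMap.ker π))

theorem finite_of_monic_smul_eq_zero [Module.Finite B[X] M] {f : B[X]} (hf : f.Monic)
    (h : ∀ x : M, f • x = 0) : Module.Finite B M := by
  have ht : Module.IsTorsionBySet B[X] M (Ideal.span {f} : Ideal B[X]) := by
    rw [Module.isTorsionBySet_span_singleton_iff]
    exact h
  let := ht.module
  have := hf.finite_quotient
  have : IsScalarTower B (B[X] ⧸ Ideal.span {f}) M := ht.isScalarTower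
  have : IsScalarTower B[X] (B[X] ⧸ Ideal.span {f}) M := ht.isScalarTower
  have : Module.Finite (B[X] ⧸ Ideal.span {f}) M :=
    Module.Finite.of_restrictScalars_finite B[X] _ _
  exact Module.Finite.trans (B[X] ⧸ Ideal.span {f}) M

end StablyFree

theorem isStablyFree_of_monic_smul_mem {B : Type u} [CommRing B] [IsNoetherianRing B]
    (hB : ProjectivesFree B) {P : Type u} [AddCommGroup P] [Module (Polynomial B) P]
    [Module.Finite (Polynomial B) P] [Module.Projective (Polynomial B) P]
    (L : Submodule (Polynomial B) P) [Module.Free (Polynomial B) L]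
    {f : Polynomial B} (hf : f.Monic) (h : ∀ x : P, f • x ∈ L) :
    Module.IsStablyFree (Polynomial B) P := by
  let : Module B P := Module.compHom P (Polynomial.C : B →+* Polynomial B)
  have : IsScalarTower B (Polynomial B) P := ⟨fun b p x => by
    rw [Polynomial.smul_eq_C_mul, mul_smul]; rfl⟩
  have : Module.Finite B (P ⧸ L) := finite_of_monic_smul_eq_zero hf (by
    intro x
    obtain ⟨x, rfl⟩ := L.mkQ_surjective x
    rw [← map_smul]
    exact (Submodule.Quotient.mk_eq_zero L).mpr (h x))
  obtain ⟨b, π, hπ⟩ := Module.Finite.exists_fin' B (P ⧸ L)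
  have : Module.Free (Polynomial B) (LinearMap.ker L.mkQ) := by
    rw [L.ker_mkQ]; infer_instance
  have : Module.Projective B P := projective_restrictScalars B (Polynomial B) P
  have : Module.Projective B (L.restrictScalars B) := projective_restrictScalars B (Polynomial B) L
  have : Module.Projective B (LinearMap.ker (L.mkQ.restrictScalars B)) :=
    Module.Projective.of_equiv (LinearEquiv.ofEq (L.restrictScalars B) (LinearMap.ker (L.mkQ.restrictScalars B)) (by
      ext x; simp))
  have := projective_ker_of_projective_ker (L.mkQ.restrictScalars B) π L.mkQ_surjective hπ
  have : Module.Free B (LinearMap.ker π) := hB _ inferInstance inferInstance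
  exact isStablyFree_of_presentation L.mkQ L.mkQ_surjective π hπ

section RowEquiv

open Matrix

variable {ι : Type*} [Fintype ι] [DecidableEq ι] {A A' : Type*} [CommRing A] [CommRing A']

/-- Two vectors are equivalent if an invertible matrix carries one to the other. -/
def VecEquiv (v w : ι → A) : Prop :=
  ∃ M N : Matrix ι ι A, M * N = 1 ∧ N * M = 1 ∧ M *ᵥ v = w

namespace VecEquiv

theorem refl (v : ι → A) : VecEquiv v v := ⟨1, 1, by simp, by simp, by simp⟩

theorem symm {v w : ι → A} (h : VecEquiv v w) : VecEquiv w v := by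
  obtain ⟨M, N, h₁, h₂, rfl⟩ := h
  exact ⟨N, M, h₂, h₁, by simp [h₂]⟩

theorem trans {u v w : ι → A} (h : VecEquiv u v) (h' : VecEquiv v w) : VecEquiv u w := by
  obtain ⟨M, N, h₁, h₂, rfl⟩ := h
  obtain ⟨M', N', h₁', h₂', rfl⟩ := h'
  refine ⟨M' * M, N * N', ?_, ?_, by simp⟩
  · rw [Matrix.mul_assoc, ← Matrix.mul_assoc M, h₁, Matrix.one_mul, h₁']
  · rw [Matrix.mul_assoc, ← Matrix.mul_assoc N', h₂', Matrix.one_mul, h₂]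

theorem map (f : A →+* A') {v w : ι → A} (h : VecEquiv v w) : VecEquiv (f ∘ v) (f ∘ w) := by
  obtain ⟨M, N, h₁, h₂, rfl⟩ := h
  refine ⟨f.mapMatrix M, f.mapMatrix N, ?_, ?_, ?_⟩
  · rw [← map_mul, h₁, map_one]
  · rw [← map_mul, h₂, map_one]
  · ext i
    exact (RingHom.map_mulVec f M v i).symm

theorem of_map_injective {f : A →+* A'} (hf : Function.Injective f) {v w : ι → A}
    {M N : Matrix ι ι A} (h₁ : f.mapMatrix M * f.mapMatrix N = 1)
    (h₂ : f.mapMatrix N * f.mapMatrix M = 1) (h : f.mapMatrix M *ᵥ (f ∘ v) = f ∘ w) :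
    VecEquiv v w := by
  have hf' : Function.Injective (f.mapMatrix (m := ι)) := Matrix.map_injective hf
  refine ⟨M, N, hf' ?_, hf' ?_, ?_⟩
  · rw [map_mul, h₁, map_one]
  · rw [map_mul, h₂, map_one]
  · ext i
    apply hf
    rw [RingHom.map_mulVec]
    exact congrFun h i

theorem add_smul (v c : ι → A) (i : ι) (hc : c i = 0) : VecEquiv v (v + v i • c) := by
  have h : vecMulVec c (Pi.single i 1) * vecMulVec c (Pi.single i 1) = 0 := by
    rw [vecMulVec_mul_vecMulVec]
    simp [hc]
  refine ⟨1 + vecMulVec c (Pi.single i 1), 1 - vecMulVec c (Pi.single i 1), ?_, ?_, ?_⟩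
  · rw [add_mul, mul_sub, mul_sub, h]; simp
  · rw [sub_mul, mul_add, mul_add, h]; simp
  · rw [add_mulVec, one_mulVec, vecMulVec_mulVec]
    ext j; simp [mul_comm]

theorem single_of_apply_eq_one (v : ι → A) (i : ι) (h : v i = 1) :
    VecEquiv v (Pi.single i 1) := by
  convert add_smul v (Pi.single i 1 - v) i (by simp [h]) using 1
  simp [h]

theorem single_of_isUnit_apply (v : ι → A) (i : ι) (h : IsUnit (v i)) :
    VecEquiv v (Pi.single i 1) := by
  obtain ⟨u, hu⟩ := h
  have hd : ∀ a b : A, a * b = 1 → diagonal (Function.update (1 : ι → A) i a) *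
      diagonal (Function.update (1 : ι → A) i b) = 1 := by
    intro a b hab
    rw [diagonal_mul_diagonal, ← diagonal_one]
    congr 1
    ext j
    rcases eq_or_ne j i with rfl | hj <;> simp_all
  refine trans ⟨diagonal (Function.update 1 i ↑u⁻¹), diagonal (Function.update 1 i ↑u),
    hd _ _ (by simp), hd _ _ (by simp), rfl⟩ (single_of_apply_eq_one _ i ?_)
  simp [mulVec_diagonal, ← hu]

theorem single_of_fin_two (v u : Fin 2 → A) (h : u ⬝ᵥ v = 1) : VecEquiv v (Pi.single 0 1) := by
  simp only [dotProduct, Fin.sum_univ_two] at h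
  refine ⟨!![u 0, u 1; -v 1, v 0], !![v 0, -u 1; v 1, u 0], ?_, ?_, ?_⟩
  · ext i j
    fin_cases i <;> fin_cases j <;> simp [Matrix.mul_apply] <;>
      first | ring1 | linear_combination h
  · ext i j
    fin_cases i <;> fin_cases j <;> simp [Matrix.mul_apply] <;>
      first | ring1 | linear_combination h
  · ext i
    fin_cases i <;> simp [Matrix.mulVec, dotProduct]
    · exact h
    · ring

theorem exists_dotProduct_eq_one {v w : ι → A} (h : VecEquiv v w) (hv : ∃ u, u ⬝ᵥ v = 1) :
    ∃ u, u ⬝ᵥ w = 1 := by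
  obtain ⟨M, N, h₁, h₂, rfl⟩ := h
  obtain ⟨u, hu⟩ := hv
  exact ⟨u ᵥ* N, by rw [← dotProduct_mulVec, mulVec_mulVec, h₂, one_mulVec, hu]⟩

end VecEquiv

end RowEquiv

section Horrocks

open Polynomial Matrix

theorem exists_monic_combination {R : Type*} [CommRing R] {f g : R[X]} {d : ℕ} (hf : f.Monic)
    (hd : f.natDegree = d + 1) (hg : g.degree < (d + 1 : ℕ)) (hu : ∃ i, IsUnit (g.coeff i)) :
    ∃ a b : R[X], (a * f + b * g).degree < (d + 1 : ℕ) ∧ (a * f + b * g).coeff d = 1 := by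
  let S : Submodule R R[X] :=
    (Ideal.span {f, g} : Ideal R[X]).restrictScalars R ⊓ degreeLT R (d + 1)
  let J : Ideal R := S.map (lcoeff R d)
  have key : ∀ m, ∀ i, i + m = d → ∀ h ∈ S, h.coeff i ∈ J := by
    intro m
    induction m with
    | zero => rintro i rfl h hh; exact ⟨h, hh, rfl⟩
    | succ m ih =>
      intro i hi h hh
      have hdJ : h.coeff d ∈ J := ⟨h, hh, rfl⟩
      have hfs : f ∈ Ideal.span {f, g} := Ideal.subset_span (by simp)
      have h' : X * h - C (h.coeff d) * f ∈ S := by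
        refine ⟨sub_mem (Ideal.mul_mem_left _ _ hh.1) (Ideal.mul_mem_left _ _ hfs), ?_⟩
        have hdeg := mem_degreeLT.mp hh.2
        rw [SetLike.mem_coe, mem_degreeLT, degree_lt_iff_coeff_zero]
        intro k hk
        obtain ⟨k, rfl⟩ : ∃ k', k = k' + 1 := ⟨k - 1, by lia⟩
        rw [coeff_sub, coeff_X_mul, coeff_C_mul]
        rcases eq_or_ne k d with rfl | hkd
        · have : f.coeff (k + 1) = 1 := by rw [← hd]; exact hf
          rw [this]; ring
        · rw [degree_lt_iff_coeff_zero] at hdeg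
          rw [hdeg k (by lia), coeff_eq_zero_of_natDegree_lt (p := f) (by lia)]
          ring
      have := ih (i + 1) (by lia) _ h'
      rw [coeff_sub, coeff_X_mul, coeff_C_mul] at this
      simpa using add_mem this (J.mul_mem_right (f.coeff (i + 1)) hdJ)
  obtain ⟨i, hi⟩ := hu
  have hgS : g ∈ S := ⟨Ideal.subset_span (by simp), mem_degreeLT.mpr hg⟩
  have hid : i ≤ d := by
    by_contra hid
    rw [degree_lt_iff_coeff_zero] at hg
    rw [hg i (by lia)] at hi
    have := (isUnit_zero_iff.mp hi)
    have hs : Subsingleton R := subsingleton_of_zero_eq_one this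
    rw [Subsingleton.elim f 0] at hd
    simp at hd
  have h1 : (1 : R) ∈ J := by
    rw [← Ideal.eq_top_iff_one]
    exact Ideal.eq_top_of_isUnit_mem _ (key (d - i) i (by lia) g hgS) hi
  obtain ⟨h, hh, h1⟩ := h1
  obtain ⟨a, b, hab⟩ := Ideal.mem_span_pair.mp hh.1
  exact ⟨a, b, by rw [hab]; exact mem_degreeLT.mp hh.2, by rw [hab]; exact h1⟩

theorem exists_isUnit_coeff {ι R : Type*} [Fintype ι] [CommRing R] [IsLocalRing R] {v u : ι → R[X]}
    (h : u ⬝ᵥ v = 1) {i : ι} (hi : (v i).Monic) (hd : (v i).natDegree ≠ 0) :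
    ∃ j ≠ i, ∃ k, IsUnit ((v j).coeff k) := by
  by_contra! hcon
  let φ := mapRingHom (IsLocalRing.residue R)
  have hz : ∀ j ≠ i, φ (v j) = 0 := by
    intro j hj
    ext k
    simpa [φ] using hcon j hj k
  have h1 : φ (u i) * φ (v i) = 1 := by
    rw [← map_one φ, ← h, dotProduct, map_sum, Finset.sum_eq_single i]
    · simp
    · intro j _ hj; rw [map_mul, hz j hj, mul_zero]
    · simp
  have hm : (φ (v i)).Monic := hi.map _
  have := hm.eq_one_of_isUnit (IsUnit.of_mul_eq_one_right _ h1)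
  apply hd
  rw [← hi.natDegree_map (IsLocalRing.residue R)]
  change (φ (v i)).natDegree = 0
  rw [this, natDegree_one]

/-- **Horrocks' theorem** for unimodular vectors over a local ring. -/
theorem VecEquiv.single_of_monic {ι R : Type*} [Fintype ι] [DecidableEq ι] [CommRing R] [IsLocalRing R]
    (hι : ∀ i j : ι, ∃ k, k ≠ i ∧ k ≠ j) (v : ι → R[X]) (hv : ∃ u, u ⬝ᵥ v = 1) (i : ι)
    (hi : (v i).Monic) : ∃ i, VecEquiv v (Pi.single i 1) := by
  induction hd : (v i).natDegree generalizing v i with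
  | zero => exact ⟨i, .single_of_apply_eq_one v i (hi.natDegree_eq_zero.mp hd)⟩
  | succ d ih =>
    let w : ι → R[X] := v + v i • fun j => if j = i then 0 else -(v j /ₘ v i)
    have hvw : VecEquiv v w := .add_smul v _ i (by simp)
    have hwi : w i = v i := by simp [w]
    have hwj : ∀ j ≠ i, (w j).degree < (d + 1 : ℕ) := by
      intro j hj
      have : w j = v j %ₘ v i := by
        simp [w, hj, modByMonic_eq_sub_mul_div, sub_eq_add_neg]
      rw [this, ← hd, ← degree_eq_natDegree hi.ne_zero]
      exact degree_modByMonic_lt _ hi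
    obtain ⟨u, hu⟩ := hvw.exists_dotProduct_eq_one hv
    obtain ⟨j, hj, hj'⟩ := exists_isUnit_coeff hu (hwi ▸ hi) (by rw [hwi, hd]; simp)
    obtain ⟨a, b, hdeg, hcoeff⟩ := exists_monic_combination (hwi ▸ hi) (hwi ▸ hd) (hwj j hj) hj'
    obtain ⟨k, hki, hkj⟩ := hι i j
    let c := C (1 - (w k).coeff d)
    let w₁ := w + w i • Pi.single k (c * a)
    have h₁ : VecEquiv w w₁ := .add_smul w _ i (by simp [hki.symm])
    let w₂ := w₁ + w₁ j • Pi.single k (c * b)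
    have h₂ : VecEquiv w₁ w₂ := .add_smul w₁ _ j (by simp [hkj.symm])
    have hw₂ : w₂ k = w k + c * (a * w i + b * w j) := by
      simp [w₂, w₁, hkj.symm]; ring
    have hdeg₂ : (w₂ k).degree < (d + 1 : ℕ) := by
      rw [hw₂]
      refine (degree_add_le _ _).trans_lt (max_lt (hwj k hki) ?_)
      rw [← smul_eq_C_mul]
      exact (degree_smul_le _ _).trans_lt hdeg
    have hcoeff₂ : (w₂ k).coeff d = 1 := by
      rw [hw₂, coeff_add, coeff_C_mul, hcoeff]; ring
    have hle : (w₂ k).natDegree ≤ d := by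
      rw [degree_lt_iff_coeff_zero] at hdeg₂
      exact natDegree_le_iff_coeff_eq_zero.mpr fun k hk => hdeg₂ k hk
    have hd₂ : (w₂ k).natDegree = d := le_antisymm hle (le_natDegree_of_ne_zero (by simp [hcoeff₂]))
    have hvw₂ := (hvw.trans h₁).trans h₂
    obtain ⟨l, hl⟩ := ih w₂ (hvw₂.exists_dotProduct_eq_one hv) k
      (by rw [Monic, leadingCoeff, hd₂, hcoeff₂]) hd₂
    exact ⟨l, hvw₂.trans hl⟩

end Horrocks

section Vaserstein

open Polynomial Matrix

/-- The substitution `Y ↦ c Y` on `A[X][Y]`. -/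
noncomputable def scaleOuter {A : Type*} [CommRing A] (c : A) : A[X][X] →+* A[X][X] :=
  eval₂RingHom C (C (C c) * X)

/-- The substitution `X ↦ X + c Y`, as a map `A[X] → A[X][Y]`. -/
noncomputable def shiftOuter {A : Type*} [CommRing A] (c : A) : A[X] →+* A[X][X] :=
  eval₂RingHom (C.comp C) (C X + C (C c) * X)

theorem scaleOuter_map {A A' : Type*} [CommRing A] [CommRing A'] (f : A →+* A') (c : A)
    (p : A[X][X]) : scaleOuter (f c) (mapRingHom (mapRingHom f) p) =
      mapRingHom (mapRingHom f) (scaleOuter c p) := by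
  have : (scaleOuter (f c)).comp (mapRingHom (mapRingHom f)) =
      (mapRingHom (mapRingHom f)).comp (scaleOuter c) := by
    ext <;> simp [scaleOuter]
  exact DFunLike.congr_fun this p

theorem shiftOuter_map {A A' : Type*} [CommRing A] [CommRing A'] (f : A →+* A') (c : A)
    (p : A[X]) : shiftOuter (f c) (mapRingHom f p) =
      mapRingHom (mapRingHom f) (shiftOuter c p) := by
  have : (shiftOuter (f c)).comp (mapRingHom f) =
      (mapRingHom (mapRingHom f)).comp (shiftOuter c) := by
    ext <;> simp [shiftOuter]
  exact DFunLike.congr_fun this p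

theorem scaleOuter_shiftOuter {A : Type*} [CommRing A] (c : A) (p : A[X]) :
    scaleOuter c (shiftOuter 1 p) = shiftOuter c p := by
  have : (scaleOuter c).comp (shiftOuter 1) = shiftOuter c := by
    ext <;> simp [shiftOuter, scaleOuter]
  exact DFunLike.congr_fun this p

theorem coeff_zero_shiftOuter {A : Type*} [CommRing A] (c : A) (p : A[X]) :
    constantCoeff (shiftOuter c p) = p := by
  have : constantCoeff.comp (shiftOuter c) = .id A[X] := by
    ext <;> simp [shiftOuter]
  exact DFunLike.congr_fun this p

section Descent

variable {R K : Type*} [CommRing R] [CommRing K] [Algebra R K] (W : Submonoid R)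
  [IsLocalization W K]

theorem exists_mul_eq_map_map (p : K[X][X]) : ∃ c ∈ W, ∃ q : R[X][X],
    C (C (algebraMap R K c)) * p = mapRingHom (mapRingHom (algebraMap R K)) q := by
  induction p using Polynomial.induction_on' with
  | add p p' hp hp' =>
    obtain ⟨c, hc, q, hq⟩ := hp
    obtain ⟨c', hc', q', hq'⟩ := hp'
    refine ⟨c * c', mul_mem hc hc', C (C c') * q + C (C c) * q', ?_⟩
    rw [map_add, map_mul _ _ q, map_mul _ _ q', ← hq, ← hq']
    simp only [map_mul, coe_mapRingHom, map_C]
    ring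
  | monomial n a =>
    obtain ⟨b, hbW, hb⟩ := IsLocalization.integerNormalization_spec W (S := K) a
    refine ⟨b, hbW, monomial n (IsLocalization.integerNormalization W a), ?_⟩
    rw [coe_mapRingHom, map_monomial, coe_mapRingHom, hb, C_mul_monomial, ← smul_eq_C_mul]
    congr 1
    ext k
    simp [Algebra.smul_def]

theorem exists_scaleOuter_eq_map (p : K[X][X]) (p₀ : R[X])
    (h : p.coeff 0 = mapRingHom (algebraMap R K) p₀) : ∃ c ∈ W, ∀ d, c ∣ d →
      ∃ q : R[X][X], scaleOuter (algebraMap R K d) p =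
        mapRingHom (mapRingHom (algebraMap R K)) q := by
  obtain ⟨c, hc, q, hq⟩ := exists_mul_eq_map_map W p.divX
  refine ⟨c, hc, ?_⟩
  rintro _ ⟨e, rfl⟩
  refine ⟨C p₀ + X * scaleOuter (c * e) (C (C e) * q), ?_⟩
  have hp : C (C (algebraMap R K (c * e))) * p.divX =
      mapRingHom (mapRingHom (algebraMap R K)) (C (C e) * q) := by
    rw [map_mul _ _ q, ← hq]
    simp only [map_mul, coe_mapRingHom, map_C]
    ring
  rw [map_add, map_mul _ X, ← scaleOuter_map, ← hp]
  conv_lhs => rw [← X_mul_divX_add p, h]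
  simp [scaleOuter]
  ring

theorem exists_forall_scaleOuter_eq_map {κ : Type*} [Finite κ] (p : κ → K[X][X]) (p₀ : κ → R[X])
    (h : ∀ k, (p k).coeff 0 = mapRingHom (algebraMap R K) (p₀ k)) : ∃ c ∈ W,
      ∃ q : κ → R[X][X], ∀ k, scaleOuter (algebraMap R K c) (p k) =
        mapRingHom (mapRingHom (algebraMap R K)) (q k) := by
  have := Fintype.ofFinite κ
  choose c hc hq using fun k => exists_scaleOuter_eq_map W (p k) (p₀ k) (h k)
  choose q hq using fun k => hq k (∏ k, c k) (Finset.dvd_prod_of_mem c (Finset.mem_univ k))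
  exact ⟨_, prod_mem fun k _ => hc k, q, hq⟩

end Descent

variable {ι : Type*} [Fintype ι] [DecidableEq ι] {R : Type u} [CommRing R]

theorem map_comp_single_one {ι A A' : Type*} [CommRing A] [CommRing A'] [DecidableEq ι]
    (f : A →+* A') (i : ι) :
    f ∘ (Pi.single i 1 : ι → A) = Pi.single i 1 := by
  ext1 j
  rcases eq_or_ne j i with rfl | hj <;> simp [*]

theorem exists_vecEquiv_shiftOuter {K : Type*} [CommRing K] [Algebra R K] (W : Submonoid R)
    [IsLocalization W K] (hK : Function.Injective (algebraMap R K)) (v : ι → R[X]) (i : ι)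
    (h : VecEquiv (fun j => mapRingHom (algebraMap R K) (v j)) (Pi.single i 1)) :
    ∃ c ∈ W, VecEquiv (fun j => shiftOuter c (v j)) (fun j => C (v j)) := by
  obtain ⟨M, N, h₁, h₂, h₃⟩ := h
  have h₄ : N *ᵥ Pi.single i 1 = fun j => mapRingHom (algebraMap R K) (v j) := by
    rw [← h₃, mulVec_mulVec, h₂, one_mulVec]
  let σ (c : K) : Matrix ι ι K[X] →+* Matrix ι ι K[X][X] := (shiftOuter c).mapMatrix
  let σ₀ : Matrix ι ι K[X] →+* Matrix ι ι K[X][X] := C.mapMatrix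
  let G (c : K) := σ₀ N * σ c M
  let G' (c : K) := σ c N * σ₀ M
  have hG (c : K) : G c * G' c = 1 := by
    simp only [G, G']
    rw [mul_assoc, ← mul_assoc (σ c M), ← map_mul (σ c), h₁, map_one, one_mul, ← map_mul, h₂,
      map_one]
  have hG' (c : K) : G' c * G c = 1 := by
    simp only [G, G']
    rw [mul_assoc, ← mul_assoc (σ₀ M), ← map_mul σ₀, h₁, map_one, one_mul, ← map_mul, h₂,
      map_one]
  have hs (c : K) : (scaleOuter c).mapMatrix (G 1) = G c ∧
      (scaleOuter c).mapMatrix (G' 1) = G' c := by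
    have hσ (A : Matrix ι ι K[X]) : (scaleOuter c).mapMatrix (σ 1 A) = σ c A := by
      ext1 j k; exact scaleOuter_shiftOuter c _
    have hσ₀ (A : Matrix ι ι K[X]) : (scaleOuter c).mapMatrix (σ₀ A) = σ₀ A := by
      ext1 j k; simp [scaleOuter, σ₀]
    simp only [G, G', map_mul]
    exact ⟨by rw [hσ, hσ₀], by rw [hσ, hσ₀]⟩
  have hc : (constantCoeff (R := K[X])).mapMatrix (G 1) = 1 ∧
      (constantCoeff (R := K[X])).mapMatrix (G' 1) = 1 := by
    have hσ (A : Matrix ι ι K[X]) : (constantCoeff (R := K[X])).mapMatrix (σ 1 A) = A := by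
      ext1 j k; exact coeff_zero_shiftOuter 1 _
    have hσ₀ (A : Matrix ι ι K[X]) : (constantCoeff (R := K[X])).mapMatrix (σ₀ A) = A := by
      ext1 j k; simp [σ₀]
    simp only [G, G', map_mul]
    exact ⟨by rw [hσ, hσ₀, h₂], by rw [hσ, hσ₀, h₂]⟩
  have h1 (j k : ι) : (1 : Matrix ι ι K[X]) j k =
      mapRingHom (algebraMap R K) ((1 : Matrix ι ι R[X]) j k) := by
    rw [Matrix.one_apply, Matrix.one_apply]; split_ifs <;> simp
  obtain ⟨c, hcW, q, hq⟩ := exists_forall_scaleOuter_eq_map W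
    (Sum.elim (fun x : ι × ι => G 1 x.1 x.2) (fun x : ι × ι => G' 1 x.1 x.2))
    (Sum.elim (fun x => (1 : Matrix ι ι R[X]) x.1 x.2) (fun x => (1 : Matrix ι ι R[X]) x.1 x.2))
    (by
      rintro (x | x)
      · exact (congrFun₂ hc.1 x.1 x.2).trans (h1 _ _)
      · exact (congrFun₂ hc.2 x.1 x.2).trans (h1 _ _))
  let φ := mapRingHom (mapRingHom (algebraMap R K))
  have e₁ : φ.mapMatrix (Matrix.of fun j k => q (.inl (j, k))) = G (algebraMap R K c) := by
    rw [← (hs _).1]; ext1 j k; exact (hq (.inl (j, k))).symm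
  have e₂ : φ.mapMatrix (Matrix.of fun j k => q (.inr (j, k))) = G' (algebraMap R K c) := by
    rw [← (hs _).2]; ext1 j k; exact (hq (.inr (j, k))).symm
  refine ⟨c, hcW, VecEquiv.of_map_injective (f := φ)
    (M := Matrix.of fun j k => q (.inl (j, k))) (N := Matrix.of fun j k => q (.inr (j, k)))
    (map_injective _ (map_injective _ hK))
    (by rw [e₁, e₂, hG]) (by rw [e₁, e₂, hG']) ?_⟩
  have hv : φ ∘ (fun j => shiftOuter c (v j)) =
      (shiftOuter (algebraMap R K c)) ∘ fun j => mapRingHom (algebraMap R K) (v j) := by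
    ext1 j; exact (shiftOuter_map _ _ _).symm
  have hv₀ : φ ∘ (fun j => C (v j)) = C ∘ fun j => mapRingHom (algebraMap R K) (v j) := by
    ext1 j; simp [φ]
  have hm (f : K[X] →+* K[X][X]) (A : Matrix ι ι K[X]) (x : ι → K[X]) :
      f.mapMatrix A *ᵥ (f ∘ x) = f ∘ (A *ᵥ x) := by
    ext1 j; exact (RingHom.map_mulVec f A x j).symm
  have hM : σ (algebraMap R K c) M *ᵥ
      (shiftOuter (algebraMap R K c) ∘ fun j => mapRingHom (algebraMap R K) (v j)) =
      C ∘ (Pi.single i 1 : ι → K[X]) := by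
    rw [hm, h₃, map_comp_single_one, map_comp_single_one]
  rw [e₁, hv, hv₀, ← mulVec_mulVec, hM, hm, h₄]

/-- **Vaserstein's theorem**: a unimodular vector over `R[X]` with a monic entry is equivalent to
its value at `0`. -/
theorem VecEquiv.eval_zero [IsDomain R] (hι : ∀ i j : ι, ∃ k, k ≠ i ∧ k ≠ j) (v : ι → R[X])
    (hv : ∃ u, u ⬝ᵥ v = 1) (i : ι) (hi : (v i).Monic) :
    VecEquiv v (fun j => C ((v j).eval 0)) := by
  let J : Ideal R :=
    { carrier := {c | ∀ (a b : R[X]),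
        VecEquiv (fun j => aeval (a + C c * b) (v j)) (fun j => aeval a (v j))}
      zero_mem' := fun a b => by simpa using VecEquiv.refl _
      add_mem' := fun {c d} hc hd a b => by
        have := (hd (a + C c * b) b).trans (hc a b)
        simpa [add_mul, add_assoc] using this
      smul_mem' := fun r c hc a b => by
        have := hc a (C r * b)
        have e : C (r • c) * b = C c * (C r * b) := by simp; ring
        rwa [e] }
  suffices hJ : J = ⊤ by
    have h1 : (1 : R) ∈ J := hJ ▸ Submodule.mem_top
    have := h1 0 X
    have e (p : R[X]) : aeval (0 : R[X]) p = C (p.eval 0) := by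
      have : (aeval (0 : R[X])).toRingHom = C.comp (evalRingHom 0) := by
        ext <;> simp [algebraMap_eq]
      exact DFunLike.congr_fun this p
    simpa [e] using this
  by_contra hJ
  obtain ⟨m, hm, hJm⟩ := Ideal.exists_le_maximal J hJ
  let φ := mapRingHom (algebraMap R (Localization.AtPrime m))
  obtain ⟨u, hu⟩ := hv
  obtain ⟨l, hl⟩ := VecEquiv.single_of_monic (R := Localization.AtPrime m) hι (fun j => φ (v j))
    ⟨fun j => φ (u j), by
      rw [← map_one φ, ← hu]; simp [dotProduct]⟩ i (hi.map _)
  obtain ⟨c, hc, h⟩ := exists_vecEquiv_shiftOuter m.primeCompl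
    (IsLocalization.injective _ m.primeCompl_le_nonZeroDivisors) v l hl
  refine hc (hJm fun a b => ?_)
  have := h.map (eval₂RingHom (aeval a).toRingHom b)
  convert this using 2 with j j
  · have : (eval₂RingHom (aeval a).toRingHom b).comp (shiftOuter c) =
      (aeval (a + C c * b)).toRingHom := by
      ext <;> simp [shiftOuter, algebraMap_eq]
    exact (DFunLike.congr_fun this (v j)).symm
  · simp

end Vaserstein

section Completable

open Matrix

/-- Every unimodular vector over `A` can be completed to an invertible matrix. -/
def UnimodularCompletable (A : Type*) [CommRing A] : Prop :=
  ∀ (n : ℕ) (v : Fin n → A), (∃ u, u ⬝ᵥ v = 1) → ∃ i, VecEquiv v (Pi.single i 1)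

open Polynomial in
theorem UnimodularCompletable.exists_vecEquiv_of_monic {B : Type u} [CommRing B] [IsDomain B]
    (hB : UnimodularCompletable B) {n : ℕ} (v : Fin n → B[X]) (hv : ∃ u, u ⬝ᵥ v = 1) (i : Fin n)
    (hi : (v i).Monic) : ∃ i, VecEquiv v (Pi.single i 1) := by
  match n with
  | 0 => exact i.elim0
  | 1 =>
    obtain ⟨u, hu⟩ := hv
    refine ⟨0, .single_of_isUnit_apply v 0 (IsUnit.of_mul_eq_one_right (u 0) ?_)⟩
    simpa [dotProduct] using hu
  | 2 =>
    obtain ⟨u, hu⟩ := hv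
    exact ⟨0, .single_of_fin_two v u hu⟩
  | n + 3 =>
    have h := VecEquiv.eval_zero (fun i j => by
      obtain ⟨k, hk⟩ := Finset.exists_mem_notMem_of_card_lt_card
        (s := {i, j}) (t := Finset.univ (α := Fin (n + 3)))
        (Finset.card_le_two.trans_lt (by simp))
      exact ⟨k, by simpa using hk⟩) v hv i hi
    obtain ⟨u, hu⟩ := hv
    obtain ⟨l, hl⟩ := hB _ (fun j => (v j).eval 0) ⟨fun j => (u j).eval 0, by
      rw [← eval_one (x := (0 : B)), ← hu]; simp [dotProduct, eval_finsetSum]⟩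
    refine ⟨l, h.trans ?_⟩
    have := hl.map C
    rwa [map_comp_single_one] at this

end Completable

section NagataAutomorphism

open Polynomial MvPolynomial Nat List

variable {k : Type*} [Field k] {n : ℕ} (b : ℕ)

/-- The endomorphism fixing `X₀` and sending `Xᵢ` to `Xᵢ + c X₀ ^ (b ^ i)` for `i ≠ 0`. -/
noncomputable def nagataHom (c : k) :
    MvPolynomial (Fin (n + 1)) k →ₐ[k] MvPolynomial (Fin (n + 1)) k :=
  aeval fun i ↦ if i = 0 then X 0 else X i + c • X 0 ^ b ^ i.1

theorem nagataHom_X_zero (c : k) : nagataHom (n := n) b c (X 0) = X 0 := by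
  simp [nagataHom]

theorem nagataHom_X_succ (c : k) (i : Fin n) :
    nagataHom b c (X i.succ) = X i.succ + c • X 0 ^ b ^ (i.1 + 1) := by
  simp [nagataHom]

theorem nagataHom_comp_neg (c : k) :
    (nagataHom (n := n) b c).comp (nagataHom b (-c)) = AlgHom.id _ _ := by
  ext i v
  cases i using Fin.cases <;> simp [nagataHom_X_zero, nagataHom_X_succ]

/-- The automorphism `nagataHom b 1`. -/
noncomputable def nagataEquiv :
    MvPolynomial (Fin (n + 1)) k ≃ₐ[k] MvPolynomial (Fin (n + 1)) k :=
  AlgEquiv.ofAlgHom (nagataHom b 1) (nagataHom b (-1))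
    (nagataHom_comp_neg b 1) (by simpa using nagataHom_comp_neg b (-1 : k))

theorem sum_pow_mul_ne (hb : 1 < b) {v w : Fin (n + 1) →₀ ℕ} (hv : ∀ i, v i < b)
    (hw : ∀ i, w i < b) (ne : v ≠ w) : ∑ x, b ^ x.1 * v x ≠ ∑ x, b ^ x.1 * w x := by
  intro h
  have hlt {v : Fin (n + 1) →₀ ℕ} (hv : ∀ i, v i < b) : ∀ l ∈ ofFn v, l < b := by grind
  refine ne <| Finsupp.ext <| congrFun <| ofFn_inj.mp ?_
  apply ofDigits_inj_of_len_eq hb (by simp) (hlt hv) (hlt hw)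
  simpa only [ofDigits_eq_sum_mapIdx, mapIdx_eq_ofFn, get_ofFn, length_ofFn,
    Fin.val_cast, mul_comm, sum_ofFn] using! h

theorem finSuccEquiv_nagataEquiv_monomial (v : Fin (n + 1) →₀ ℕ) (a : k) :
    finSuccEquiv k n (nagataEquiv b (monomial v a)) = Polynomial.C (MvPolynomial.C a) *
      (Polynomial.X ^ v 0 * ∏ i : Fin n,
        (Polynomial.X ^ b ^ (i.1 + 1) + Polynomial.C (X i)) ^ v i.succ) := by
  rw [monomial_eq, Finsupp.prod_pow v fun a ↦ X a]
  simp only [Fin.prod_univ_succ, map_mul, map_prod, map_pow, nagataEquiv,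
    AlgEquiv.ofAlgHom_apply, nagataHom_X_zero, nagataHom_X_succ, map_add, one_smul,
    finSuccEquiv_X_zero, finSuccEquiv_X_succ, algHom_C, algebraMap_eq]
  congr 1
  · simp [finSuccEquiv_apply]
  · simp only [add_comm]

theorem monic_X_pow_pow_add_C (hb : 1 < b) (i : Fin n) : (Polynomial.X ^ b ^ (i.1 + 1) +
    Polynomial.C (X i : MvPolynomial (Fin n) k)).Monic :=
  monic_X_pow_add_C _ (pow_ne_zero _ (by lia))

theorem leadingCoeff_finSuccEquiv_nagataEquiv_monomial (hb : 1 < b) (v : Fin (n + 1) →₀ ℕ) (a : k) :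
    (finSuccEquiv k n (nagataEquiv b (monomial v a))).leadingCoeff = MvPolynomial.C a := by
  simp [finSuccEquiv_nagataEquiv_monomial, leadingCoeff_mul, leadingCoeff_prod,
    (monic_X_pow_pow_add_C b hb _).leadingCoeff]

theorem natDegree_finSuccEquiv_nagataEquiv_monomial (hb : 1 < b) (v : Fin (n + 1) →₀ ℕ) {a : k} (ha : a ≠ 0) :
    (finSuccEquiv k n (nagataEquiv b (monomial v a))).natDegree = ∑ x, b ^ x.1 * v x := by
  have hm (i : Fin n) := monic_X_pow_pow_add_C (k := k) b hb i
  rw [finSuccEquiv_nagataEquiv_monomial, natDegree_C_mul (by simpa),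
    (Monic.natDegree_mul (monic_X_pow _) (monic_prod_of_monic _ _ fun i _ => (hm i).pow _)),
    natDegree_prod_of_monic _ _ fun i _ => (hm i).pow _, Fin.sum_univ_succ]
  simp [(hm _).natDegree_pow, mul_comm]

theorem isUnit_leadingCoeff_finSuccEquiv_nagataEquiv (hb : 1 < b)
    (f : MvPolynomial (Fin (n + 1)) k) (hf : f ≠ 0) (hfb : f.totalDegree < b) :
    IsUnit (finSuccEquiv k n (nagataEquiv b f)).leadingCoeff := by
  let g (w : Fin (n + 1) →₀ ℕ) := finSuccEquiv k n (nagataEquiv b (monomial w (coeff w f)))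
  obtain ⟨v, hv, hmax⟩ := Finset.exists_max_image f.support (fun v ↦ (g v).natDegree)
    (support_nonempty.mpr hf)
  have hlt (w) (hw : w ∈ f.support) (i) : w i < b :=
    ((monomial_le_degreeOf i hw).trans (degreeOf_le_totalDegree f i)).trans_lt hfb
  have hdeg (w) (hw : w ∈ f.support.erase v) : (g w).degree < (g v).degree := by
    obtain ⟨hwv, hw⟩ := Finset.mem_erase.mp hw
    refine degree_lt_degree ((hmax w hw).lt_of_ne ?_)
    simp only [g]
    rw [natDegree_finSuccEquiv_nagataEquiv_monomial b hb _ (mem_support_iff.mp hw),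
      natDegree_finSuccEquiv_nagataEquiv_monomial b hb _ (mem_support_iff.mp hv)]
    exact sum_pow_mul_ne b hb (hlt w hw) (hlt v hv) hwv
  have hsum : finSuccEquiv k n (nagataEquiv b f) = ∑ w ∈ f.support.erase v, g w + g v := by
    rw [Finset.sum_erase_add _ _ hv]
    conv_lhs => rw [← f.support_sum_monomial_coeff, map_sum, map_sum]
  have hv0 : g v ≠ 0 := by simpa [g] using mem_support_iff.mp hv
  rw [hsum, leadingCoeff_add_of_degree_lt, leadingCoeff_finSuccEquiv_nagataEquiv_monomial b hb]
  · exact (IsUnit.mk0 _ (mem_support_iff.mp hv)).map MvPolynomial.C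
  · refine (degree_sum_le _ _).trans_lt ((Finset.sup_lt_iff ?_).mpr hdeg)
    exact (degree_ne_bot.mpr hv0).bot_lt

theorem exists_ringEquiv_monic {f : MvPolynomial (Fin (n + 1)) k} (hf : f ≠ 0) :
    ∃ (E : MvPolynomial (Fin (n + 1)) k ≃+* (MvPolynomial (Fin n) k)[X])
      (u : (MvPolynomial (Fin n) k)ˣ), (Polynomial.C (u : MvPolynomial (Fin n) k) * E f).Monic := by
  obtain ⟨u, hu⟩ := isUnit_leadingCoeff_finSuccEquiv_nagataEquiv (2 + f.totalDegree) (by lia) f hf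
    (by lia)
  refine ⟨((nagataEquiv (2 + f.totalDegree)).trans (finSuccEquiv k n)).toRingEquiv, u⁻¹, ?_⟩
  rw [Monic, leadingCoeff_mul, leadingCoeff_C]
  change _ * (finSuccEquiv k n (nagataEquiv _ f)).leadingCoeff = 1
  rw [← hu, Units.inv_mul]

end NagataAutomorphism

section RingEquivTransfer

attribute [local instance] RingHomInvPair.of_ringEquiv RingHomInvPair.of_ringEquiv_symm

theorem ProjectivesFree.of_ringEquiv {A A' : Type u} [CommRing A] [CommRing A'] (E : A ≃+* A')
    (h : ProjectivesFree A) : ProjectivesFree A' := by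
  intro P _ _ _ _
  let : Module A P := Module.compHom P (E : A →+* A')
  let e : P ≃ₛₗ[(E.symm : A' →+* A)] P :=
    { AddEquiv.refl P with
      map_smul' := fun a x => by
        change a • x = E (E.symm a) • x
        rw [E.apply_symm_apply] }
  have : Module.Finite A P := Module.Finite.of_surjective e.toLinearMap e.surjective
  have : Module.Projective A P := Module.Projective.of_equiv e
  have : Module.Free A P := h P inferInstance inferInstance
  exact Module.Free.of_equiv e.symm

theorem UnimodularCompletable.of_ringEquiv {A A' : Type*} [CommRing A] [CommRing A']
    (E : A ≃+* A') (h : UnimodularCompletable A) : UnimodularCompletable A' := by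
  rintro n v ⟨u, hu⟩
  obtain ⟨i, hi⟩ := h n (E.symm ∘ v) ⟨E.symm ∘ u, by
    rw [← map_one E.symm, ← hu]; simp [dotProduct]⟩
  have := hi.map (E : A →+* A')
  refine ⟨i, ?_⟩
  rw [map_comp_single_one] at this
  simpa [Function.comp_def] using this

end RingEquivTransfer

section FreeOfCompletable

variable {A P : Type u} [CommRing A] [Nontrivial A] [AddCommGroup P] [Module A P]

theorem UnimodularCompletable.free_of_free_prod_self (hA : UnimodularCompletable A)
    [Module.Finite A P] [Module.Free A (P × A)] : Module.Free A P := by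
  let e : (P × A) ≃ₗ[A] (Fin (Module.finrank A (P × A)) → A) :=
    (Module.finBasis A (P × A)).equivFun
  obtain ⟨i, M, N, h₁, h₂, h₃⟩ := hA _ (e (0, 1)) ⟨fun i => (e.symm (Pi.single i 1)).2, by
    have := congrArg Prod.snd (e.symm_apply_apply (0, 1))
    conv_lhs at this => rw [pi_eq_sum_univ' (e (0, 1)), map_sum, Prod.snd_sum]
    simpa [dotProduct, mul_comm, Pi.single_apply, funext_iff] using this⟩
  let E : (P × A) ≃ₗ[A] (Fin (Module.finrank A (P × A)) → A) :=
    e ≪≫ₗ Matrix.toLin'OfInv h₂ h₁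
  have hE : E (0, 1) = Pi.single i 1 := h₃
  have hE' (a : A) : E (0, a) = Pi.single i a := by
    rw [← mul_one a, ← smul_eq_mul, ← smul_zero a, ← Prod.smul_mk, map_smul, hE, ← Pi.single_smul]
  let φ : P →ₗ[A] ({j // j ≠ i} → A) :=
    LinearMap.funLeft A A Subtype.val ∘ₗ E.toLinearMap ∘ₗ LinearMap.inl A P A
  refine Module.Free.of_equiv (LinearEquiv.ofBijective φ ⟨?_, fun y => ?_⟩).symm
  · rw [← LinearMap.ker_eq_bot, LinearMap.ker_eq_bot']
    intro p hp
    have : E (p, 0) = E (0, E (p, 0) i) := by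
      rw [hE']
      ext j
      rcases eq_or_ne j i with rfl | hj
      · simp
      · rw [Pi.single_eq_of_ne hj]
        exact congrFun hp ⟨j, hj⟩
    exact congrArg Prod.fst (E.injective this)
  · let z : Fin (Module.finrank A (P × A)) → A := fun j => if h : j ≠ i then y ⟨j, h⟩ else 0
    refine ⟨(E.symm z).1, ?_⟩
    have : E ((E.symm z).1, 0) = z - Pi.single i (E.symm z).2 := by
      rw [← hE', eq_sub_iff_add_eq, ← map_add, Prod.mk_add_mk, add_zero, zero_add]
      exact E.apply_symm_apply z
    ext j
    change E ((E.symm z).1, 0) j = y j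
    rw [this]
    simp [z, j.2]

theorem UnimodularCompletable.free_of_free_prod (hA : UnimodularCompletable A)
    [Module.Finite A P] (n : ℕ) [Module.Free A (P × (Fin n → A))] : Module.Free A P := by
  induction n generalizing P with
  | zero => exact Module.Free.of_equiv (LinearEquiv.prodUnique (R := A) (M := P) (M₂ := Fin 0 → A))
  | succ n ih =>
    have : Module.Free A ((P × A) × (Fin n → A)) :=
      Module.Free.of_equiv ((LinearEquiv.refl A P).prodCongr
        (Fin.consLinearEquiv A fun _ => A).symm ≪≫ₗ (LinearEquiv.prodAssoc A P A _).symm)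
    have : Module.Free A (P × A) := ih
    exact hA.free_of_free_prod_self

theorem UnimodularCompletable.free_of_isStablyFree (hA : UnimodularCompletable A)
    [Module.Finite A P] [Module.IsStablyFree A P] : Module.Free A P := by
  obtain ⟨N, _, _, _, _, _⟩ := Module.IsStablyFree.exist_free_prod A P
  have : Module.Free A (P × (Fin (Module.finrank A N) → A)) :=
    Module.Free.of_equiv ((LinearEquiv.refl A P).prodCongr (Module.finBasis A N).equivFun)
  exact hA.free_of_free_prod (Module.finrank A N)

end FreeOfCompletable

section Scaling

variable {R P : Type*} [CommRing R] [AddCommGroup P] [Module R P] (W : Submonoid R)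

theorem exists_mem_forall_smul_mem [Module.Finite R P] (L : Submodule R P)
    (h : ∀ x : P, ∃ w ∈ W, w • x ∈ L) : ∃ w ∈ W, ∀ x : P, w • x ∈ L := by
  obtain ⟨n, s, hs⟩ := Module.Finite.exists_fin (R := R) (M := P)
  choose w hw hL using fun i => h (s i)
  refine ⟨∏ i, w i, prod_mem fun i _ => hw i, ?_⟩
  suffices ⊤ ≤ L.comap (LinearMap.lsmul R P (∏ i, w i)) from fun x => this Submodule.mem_top
  rw [← hs, Submodule.span_le]
  rintro _ ⟨i, rfl⟩
  obtain ⟨d, hd⟩ := Finset.dvd_prod_of_mem w (Finset.mem_univ i)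
  change (∏ i, w i) • s i ∈ L
  rw [hd, mul_comm, mul_smul]
  exact L.smul_mem d (hL i)

theorem exists_linearIndependent_smul_mem_span (hW : W ≤ nonZeroDivisors R) (K : Type*)
    [CommRing K] [Nontrivial K] [Algebra R K] [IsLocalization W K] [Module.Finite R P]
    [Module.Free K (K ⊗[R] P)] : ∃ (r : ℕ) (e : Fin r → P), LinearIndependent R e ∧
      ∃ w ∈ W, ∀ x : P, w • x ∈ Submodule.span R (Set.range e) := by
  let f := TensorProduct.mk R K P 1
  have : IsLocalizedModule W f := inferInstance
  let b := Module.finBasis K (K ⊗[R] P)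
  choose x hx using fun i => IsLocalizedModule.surj W f (b i)
  let u (i) : Kˣ := (IsLocalization.map_units K (x i).2).unit
  let b' := b.unitsSMul u
  have hb' (i) : b' i = f (x i).1 := by
    rw [← hx, Module.Basis.unitsSMul_apply]
    simp only [u, Units.smul_def, IsUnit.unit_spec, algebraMap_smul]
    rfl
  refine ⟨_, fun i => (x i).1, ?_, exists_mem_forall_smul_mem W _ fun p => ?_⟩
  · rw [Fintype.linearIndependent_iff]
    intro g hg i
    have : ∑ j, algebraMap R K (g j) • b' j = 0 := by
      simp_rw [hb', algebraMap_smul, ← map_smul, ← map_sum, hg, map_zero]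
    have := Fintype.linearIndependent_iff.mp b'.linearIndependent _ this i
    exact (map_eq_zero_iff _ (IsLocalization.injective K hW)).mp this
  · obtain ⟨w, hw⟩ := IsLocalization.exist_integer_multiples_of_finite W (b'.repr (f p))
    choose c hc using hw
    have : f ((w : R) • p) = f (∑ i, c i • (x i).1) := by
      rw [map_smul, map_sum]
      conv_lhs => rw [← b'.sum_repr (f p), Finset.smul_sum]
      refine Finset.sum_congr rfl fun i _ => ?_
      rw [map_smul, ← hb', ← smul_assoc, ← hc, algebraMap_smul]
    obtain ⟨w', hw'⟩ := (IsLocalizedModule.eq_iff_exists W f).mp this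
    refine ⟨w' * w, mul_mem w'.2 w.2, ?_⟩
    rw [mul_smul]
    change w' • (w : R) • p ∈ _
    rw [hw']
    exact Submodule.smul_mem _ (w' : R) (sum_mem fun i _ => Submodule.smul_mem _ _
      (Submodule.subset_span ⟨i, rfl⟩))

end Scaling

section QuillenSuslin

open Polynomial

theorem VecEquiv.units_smul {ι A : Type*} [Fintype ι] [DecidableEq ι] [CommRing A] (c : Aˣ)
    (v : ι → A) : VecEquiv v ((c : A) • v) :=
  ⟨(c : A) • 1, ((c⁻¹ : Aˣ) : A) • 1, by simp [smul_smul], by simp [smul_smul],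
    by simp [Matrix.smul_mulVec]⟩

variable {k : Type u} [Field k]

attribute [local instance] RingHomInvPair.of_ringEquiv RingHomInvPair.of_ringEquiv_symm

theorem UnimodularCompletable.mvPolynomial_succ {n : ℕ}
    (h : UnimodularCompletable (MvPolynomial (Fin n) k)) :
    UnimodularCompletable (MvPolynomial (Fin (n + 1)) k) := by
  rintro m v ⟨u, hu⟩
  obtain ⟨i, hi⟩ : ∃ i, v i ≠ 0 := by
    by_contra! hv
    simp [dotProduct, hv] at hu
  obtain ⟨E, c, hc⟩ := exists_ringEquiv_monic hi
  let v' : Fin m → (MvPolynomial (Fin n) k)[X] := E ∘ v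
  have hv' : VecEquiv v' _ := .units_smul (c.map C.toMonoidHom) v'
  obtain ⟨l, hl⟩ := h.exists_vecEquiv_of_monic _ (hv'.exists_dotProduct_eq_one ⟨E ∘ u, by
    rw [← map_one E, ← hu]; simp [dotProduct, v']⟩) i hc
  have := (hv'.trans hl).map (E.symm : _ →+* MvPolynomial (Fin (n + 1)) k)
  refine ⟨l, ?_⟩
  rw [map_comp_single_one] at this
  simpa [Function.comp_def, v'] using this

theorem ProjectivesFree.mvPolynomial_succ {n : ℕ}
    (h : ProjectivesFree (MvPolynomial (Fin n) k))
    (hA : UnimodularCompletable (MvPolynomial (Fin (n + 1)) k)) :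
    ProjectivesFree (MvPolynomial (Fin (n + 1)) k) := by
  intro P _ _ _ _
  obtain ⟨r, e, he, w, hw, hwe⟩ := exists_linearIndependent_smul_mem_span (P := P)
    (nonZeroDivisors (MvPolynomial (Fin (n + 1)) k)) le_rfl
    (FractionRing (MvPolynomial (Fin (n + 1)) k))
  obtain ⟨E, c, hc⟩ := exists_ringEquiv_monic (nonZeroDivisors.ne_zero hw)
  let : Module (MvPolynomial (Fin n) k)[X] P :=
    Module.compHom P (E.symm : _ →+* MvPolynomial (Fin (n + 1)) k)
  have hsmul (a : (MvPolynomial (Fin n) k)[X]) (x : P) : a • x = E.symm a • x := rfl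
  have hsmul' (a : MvPolynomial (Fin (n + 1)) k) (x : P) : E a • x = a • x := by
    rw [hsmul, E.symm_apply_apply]
  let L : Submodule (MvPolynomial (Fin n) k)[X] P := Submodule.span _ (Set.range e)
  have hL : ∀ x : P, (C (c : MvPolynomial (Fin n) k) * E w) • x ∈ L := by
    intro x
    rw [mul_smul, hsmul']
    refine L.smul_mem _ ?_
    have hy := hwe x
    generalize w • x = y at hy ⊢
    induction hy using Submodule.span_induction with
    | mem x hx => exact Submodule.subset_span hx
    | zero => exact zero_mem _
    | add x y _ _ hx hy => exact add_mem hx hy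
    | smul a x _ hx => rw [← hsmul']; exact L.smul_mem _ hx
  have he' : LinearIndependent (MvPolynomial (Fin n) k)[X] e := by
    rw [Fintype.linearIndependent_iff] at he ⊢
    intro g hg i
    exact (map_eq_zero_iff E.symm E.symm.injective).mp (he (E.symm ∘ g) hg i)
  have : Module.Free (MvPolynomial (Fin n) k)[X] L := .of_basis (Module.Basis.span he')
  let ε : P ≃ₛₗ[(E : MvPolynomial (Fin (n + 1)) k →+* (MvPolynomial (Fin n) k)[X])] P :=
    { AddEquiv.refl P with
      map_smul' := fun a x => by
        change a • x = E a • x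
        exact (hsmul' a x).symm }
  have : Module.Finite (MvPolynomial (Fin n) k)[X] P :=
    Module.Finite.of_surjective ε.toLinearMap ε.surjective
  have : Module.Projective (MvPolynomial (Fin n) k)[X] P := Module.Projective.of_equiv ε
  have := isStablyFree_of_monic_smul_mem h L hc hL
  have := (hA.of_ringEquiv E).free_of_isStablyFree (P := P)
  exact Module.Free.of_equiv ε.symm

theorem quillenSuslin (n : ℕ) : ProjectivesFree (MvPolynomial (Fin n) k) ∧
    UnimodularCompletable (MvPolynomial (Fin n) k) := by
  induction n with
  | zero =>
    let E := (MvPolynomial.isEmptyAlgEquiv k (Fin 0)).symm.toRingEquiv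
    refine ⟨.of_ringEquiv E fun P _ _ _ _ => inferInstance, .of_ringEquiv E ?_⟩
    rintro n v ⟨u, hu⟩
    obtain ⟨i, hi⟩ : ∃ i, v i ≠ 0 := by
      by_contra! hv
      simp [dotProduct, hv] at hu
    exact ⟨i, .single_of_isUnit_apply v i hi.isUnit⟩
  | succ n ih => exact ⟨ih.1.mvPolynomial_succ ih.2.mvPolynomial_succ, ih.2.mvPolynomial_succ⟩

end QuillenSuslin

section LocalizationDescent

variable {A R P : Type*} [CommRing A] [CommRing R] [Algebra A R] (S : Submonoid A)
  [IsLocalization S R] [AddCommGroup P] [Module A P] [Module R P] [IsScalarTower A R P]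

theorem exists_comp_eq_smul_of_isLocalization (hS : S ≤ nonZeroDivisors A) [Module.Projective R P]
    (Q : Submodule A P) (hQ : Submodule.span R (Q : Set P) = ⊤) {m : ℕ}
    (π : (Fin m → A) →ₗ[A] Q) (hπ : Function.Surjective π) :
    ∃ s ∈ S, ∃ h : Q →ₗ[A] (Fin m → A), ∀ x, π (h x) = s • x := by
  let q (i : Fin m) : Q := π (Pi.single i 1)
  have hq (a : Fin m → A) : π a = ∑ i, a i • q i := by
    conv_lhs => rw [pi_eq_sum_univ' a, map_sum]
    simp [q]
  let πR : (Fin m → R) →ₗ[R] P := Fintype.linearCombination R fun i => (q i : P)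
  have hπR : Function.Surjective πR := by
    rw [← LinearMap.range_eq_top, ← top_le_iff, ← hQ, Submodule.span_le]
    intro x hx
    obtain ⟨a, ha⟩ := hπ ⟨x, hx⟩
    refine ⟨fun i => algebraMap A R (a i), ?_⟩
    rw [hq] at ha
    simpa [πR, Fintype.linearCombination_apply] using congrArg Subtype.val ha
  obtain ⟨σ, hσ⟩ := Module.projective_lifting_property πR LinearMap.id hπR
  obtain ⟨s, hs⟩ := IsLocalization.exist_integer_multiples_of_finite S
    fun x : Fin m × Fin m => σ (q x.1) x.2
  choose c hc using hs
  let ι : (Fin m → A) →ₗ[A] (Fin m → R) := (Algebra.linearMap A R).compLeft (Fin m)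
  have hι : Function.Injective ι := fun a b hab => funext fun i =>
    IsLocalization.injective R hS (congrFun hab i)
  let g : Q →ₗ[A] (Fin m → R) := (s : A) • (σ.restrictScalars A ∘ₗ Q.subtype)
  have hg : ∀ x, g x ∈ LinearMap.range ι := by
    intro x
    obtain ⟨a, rfl⟩ := hπ x
    rw [hq, map_sum]
    refine sum_mem fun i _ => ?_
    rw [map_smul]
    exact Submodule.smul_mem _ _ ⟨fun j => c (i, j), funext fun j => hc (i, j)⟩
  refine ⟨s, s.2, (LinearEquiv.ofInjective ι hι).symm.toLinearMap ∘ₗ g.codRestrict _ hg, ?_⟩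
  intro x
  have h₁ : ι ((LinearEquiv.ofInjective ι hι).symm (g.codRestrict _ hg x)) = g x :=
    congrArg Subtype.val ((LinearEquiv.ofInjective ι hι).apply_symm_apply _)
  have h₂ (a : Fin m → A) : (π a : P) = πR (ι a) := by
    rw [hq]
    simp [πR, ι, Fintype.linearCombination_apply]
  apply Subtype.ext
  rw [LinearMap.comp_apply, h₂]
  refine (congrArg πR h₁).trans ?_
  have : πR (σ x) = x := LinearMap.congr_fun hσ x
  simp only [g, LinearMap.smul_apply, LinearMap.comp_apply, LinearMap.restrictScalars_apply,
    Submodule.subtype_apply, Submodule.coe_smul]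
  rw [← algebraMap_smul R (s : A) (σ x), map_smul, this, algebraMap_smul]

/-- A module between a lattice `F` and its localization is projective if it is so after inverting
`S` and a power of an element comaximal to `S` carries it into `F`. -/
theorem projective_of_isLocalization_of_smul_mem (hS : S ≤ nonZeroDivisors A)
    [Module.Projective R P] (Q : Submodule A P) (hQ : Submodule.span R (Q : Set P) = ⊤)
    [Module.Finite A Q] (F : Submodule A Q) [Module.Projective A F] {t : A}
    (hcop : ∀ s ∈ S, IsCoprime s t) (ht : ∀ x : Q, t • x ∈ F) : Module.Projective A Q := by
  obtain ⟨m, π, hπ⟩ := Module.Finite.exists_fin' A Q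
  obtain ⟨s, hs, h, hh⟩ := exists_comp_eq_smul_of_isLocalization S (R := R) hS Q hQ π hπ
  obtain ⟨h', hh'⟩ := Module.projective_lifting_property π F.subtype hπ
  let g : Q →ₗ[A] F := (LinearMap.lsmul A Q t).codRestrict F ht
  obtain ⟨a, b, hab⟩ := hcop s hs
  refine Module.Projective.of_split (a • h + b • (h' ∘ₗ g)) π (LinearMap.ext fun x => ?_)
  have h₁ : π (h' (g x)) = t • x := LinearMap.congr_fun hh' (g x)
  simp [hh, h₁, smul_smul, ← add_smul, hab]

end LocalizationDescent

/-- If finitely generated projective modules over `A` are free, a finitely generated projective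
module over a localization `S⁻¹A` is free as soon as multiplication by an element of `A` comaximal
to `S` carries it into a free submodule. -/
theorem ProjectivesFree.free_of_isLocalization {A R P : Type u} [CommRing A] [CommRing R]
    [Algebra A R] (S : Submonoid A) [IsLocalization S R] (hA : ProjectivesFree A)
    (hS : S ≤ nonZeroDivisors A) [AddCommGroup P] [Module R P] [Module.Finite R P]
    [Module.Projective R P] {t : A} (hcop : ∀ s ∈ S, IsCoprime s t) {r : ℕ} (e : Fin r → P)
    (he : LinearIndependent R e)
    (ht : ∀ x : P, algebraMap A R t • x ∈ Submodule.span R (Set.range e)) : Module.Free R P := by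
  let : Module A P := Module.compHom P (algebraMap A R)
  have : IsScalarTower A R P := ⟨fun a b x => by
    rw [Algebra.smul_def, mul_smul]; rfl⟩
  obtain ⟨n, p, hp⟩ := Module.Finite.exists_fin (R := R) (M := P)
  choose c hc using fun i => (Submodule.mem_span_range_iff_exists_fun R).mp (ht (p i))
  obtain ⟨s, hs⟩ := IsLocalization.exist_integer_multiples_of_finite S
    fun x : Fin n × Fin r => c x.1 x.2
  choose a ha using hs
  let Q : Submodule A P :=
    Submodule.span A (Set.range (fun i => (s : A) • p i) ∪ Set.range e)
  have : Module.Finite A Q := Module.Finite.span_of_finite A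
    ((Set.finite_range _).union (Set.finite_range _))
  have heQ (j) : e j ∈ Q := Submodule.subset_span (.inr ⟨j, rfl⟩)
  have hQ : Submodule.span R (Q : Set P) = ⊤ := by
    rw [← top_le_iff, ← hp, Submodule.span_le]
    rintro _ ⟨i, rfl⟩
    have h₁ : algebraMap A R s • p i ∈ Submodule.span R (Q : Set P) := by
      rw [algebraMap_smul]
      exact Submodule.subset_span (Submodule.subset_span (.inl ⟨i, rfl⟩))
    exact (Submodule.smul_mem_iff_of_isUnit _ (IsLocalization.map_units R s)).mp h₁
  have : FaithfulSMul A R :=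
    (faithfulSMul_iff_algebraMap_injective A R).mpr (IsLocalization.injective R hS)
  have heA : LinearIndependent A e := he.restrict_scalars' A
  let e' (j : Fin r) : Q := ⟨e j, heQ j⟩
  have he' : LinearIndependent A e' := LinearIndependent.of_comp Q.subtype heA
  let F : Submodule A Q := Submodule.span A (Set.range e')
  have : Module.Free A F := .of_basis (Module.Basis.span he')
  have hQF : Q ≤ (Submodule.span A (Set.range e)).comap (LinearMap.lsmul A P t) := by
    refine Submodule.span_le.mpr (Set.union_subset ?_ ?_)
    · rintro _ ⟨i, rfl⟩
      have : t • (s : A) • p i = ∑ j, a (i, j) • e j := by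
        rw [smul_comm, ← algebraMap_smul R t, ← hc, Finset.smul_sum]
        refine Finset.sum_congr rfl fun j _ => ?_
        rw [← algebraMap_smul R (a (i, j)), ha, smul_assoc]
      change t • (s : A) • p i ∈ Submodule.span A (Set.range e)
      rw [this]
      exact sum_mem fun j _ => Submodule.smul_mem _ _ (Submodule.subset_span ⟨j, rfl⟩)
    · rintro _ ⟨j, rfl⟩
      exact Submodule.smul_mem (Submodule.span A (Set.range e)) t
        (Submodule.subset_span ⟨j, rfl⟩)
  have hF : ∀ x : Q, t • x ∈ F := by
    intro x
    have h : t • (x : P) ∈ F.map Q.subtype := by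
      rw [Submodule.map_span, ← Set.range_comp]
      exact hQF x.2
    obtain ⟨y, hy, hyx⟩ := h
    rwa [← show y = t • x from Subtype.ext hyx]
  have : Module.Projective A Q :=
    projective_of_isLocalization_of_smul_mem S (R := R) hS Q hQ F hcop hF
  have : Module.Free A Q := hA Q inferInstance inferInstance
  let b := Module.Free.chooseBasis A Q
  have hb : LinearIndependent A fun i => (b i : P) :=
    b.linearIndependent.map' Q.subtype Q.ker_subtype
  refine Module.Free.of_basis (Module.Basis.mk (hb.localization R S) ?_)
  rw [← hQ, Submodule.span_le]
  intro x hx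
  have : x ∈ (Submodule.span A (Set.range b)).map Q.subtype := by
    rw [b.span_eq, Submodule.map_top, Submodule.range_subtype]; exact hx
  rw [Submodule.map_span, ← Set.range_comp] at this
  exact Submodule.span_le_restrictScalars A R _ this

section PolynomialsOverRtwo

instance isLocalization_Rtwo :
    IsLocalization (Ideal.span {(Polynomial.X : Polynomial ℂ)}).primeCompl Rtwo :=
  inferInstanceAs (IsLocalization _ (Localization _))

instance isDomain_Rtwo : IsDomain Rtwo :=
  IsLocalization.isDomain_of_le_nonZeroDivisors Rtwo
    (Ideal.span {(Polynomial.X : Polynomial ℂ)}).primeCompl_le_nonZeroDivisors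

instance isNoetherianRing_Rtwo : IsNoetherianRing Rtwo :=
  IsLocalization.isNoetherianRing (Ideal.span {(Polynomial.X : Polynomial ℂ)}).primeCompl Rtwo
    inferInstance

theorem exists_dvd_algebraMap_X_pow {v : Rtwo} (hv : v ≠ 0) :
    ∃ k, v ∣ algebraMap (Polynomial ℂ) Rtwo Polynomial.X ^ k := by
  obtain ⟨⟨a, s⟩, ha⟩ :=
    IsLocalization.surj (Ideal.span {(Polynomial.X : Polynomial ℂ)}).primeCompl v
  have hs := IsLocalization.map_units Rtwo s
  have ha₀ : a ≠ 0 := by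
    rintro rfl
    rw [map_zero] at ha
    exact (mul_ne_zero hv hs.ne_zero) ha
  obtain ⟨k, b, hb, rfl⟩ := WfDvdMonoid.max_power_factor ha₀ Polynomial.irreducible_X
  have hb' := IsLocalization.map_units Rtwo
    (⟨b, fun h => hb (Ideal.mem_span_singleton.mp h)⟩ :
      (Ideal.span {(Polynomial.X : Polynomial ℂ)}).primeCompl)
  refine ⟨k, ?_⟩
  rw [← hb'.dvd_mul_right, ← map_pow, ← map_mul, ← ha]
  exact dvd_mul_right _ _

attribute [local instance] MvPolynomial.algebraMvPolynomial

theorem projectivesFree_mvPolynomial_polynomial (k : Type u) [Field k] (n : ℕ) :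
    ProjectivesFree (MvPolynomial (Fin n) (Polynomial k)) :=
  .of_ringEquiv ((MvPolynomial.renameEquiv k (finSuccEquiv n)).trans
    (MvPolynomial.optionEquivRight k (Fin n))).toRingEquiv (quillenSuslin (n + 1)).1

theorem map_C_nonZeroDivisors_le {σ B : Type*} [CommRing B] [IsDomain B] :
    (nonZeroDivisors B).map (MvPolynomial.C (σ := σ)) ≤
      nonZeroDivisors (MvPolynomial σ B) := by
  rintro _ ⟨v, hv, rfl⟩
  exact mem_nonZeroDivisors_of_ne_zero
    ((MvPolynomial.C_ne_zero).mpr (nonZeroDivisors.ne_zero hv))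

theorem projectivesFree_mvPolynomial_Rtwo (n : ℕ) :
    ProjectivesFree (MvPolynomial (Fin n) Rtwo) := by
  intro P _ _ _ _
  let K := FractionRing Rtwo
  have : Module.Free (MvPolynomial (Fin n) K)
      (MvPolynomial (Fin n) K ⊗[MvPolynomial (Fin n) Rtwo] P) :=
    (quillenSuslin (k := K) n).1 (MvPolynomial (Fin n) K ⊗[MvPolynomial (Fin n) Rtwo] P)
      inferInstance inferInstance
  obtain ⟨r, e, he, _, ⟨v, hv, rfl⟩, hwe⟩ := exists_linearIndependent_smul_mem_span
    (R := MvPolynomial (Fin n) Rtwo) (P := P)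
    ((nonZeroDivisors Rtwo).map MvPolynomial.C) map_C_nonZeroDivisors_le (MvPolynomial (Fin n) K)
  obtain ⟨k, d, hd⟩ := exists_dvd_algebraMap_X_pow (nonZeroDivisors.ne_zero hv)
  let M := (Ideal.span {(Polynomial.X : Polynomial ℂ)}).primeCompl
  refine (projectivesFree_mvPolynomial_polynomial ℂ n).free_of_isLocalization
    (M.map (MvPolynomial.C (σ := Fin n)))
    ((Submonoid.monotone_map (Ideal.primeCompl_le_nonZeroDivisors _)).trans map_C_nonZeroDivisors_le)
    (t := MvPolynomial.C (Polynomial.X ^ k)) ?_ e he fun x => ?_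
  · rintro _ ⟨s, hs, rfl⟩
    have : IsCoprime Polynomial.X s := Polynomial.irreducible_X.coprime_iff_not_dvd.mpr
      fun h => hs (Ideal.mem_span_singleton.mpr h)
    exact (this.symm.pow_right).map MvPolynomial.C
  · rw [MvPolynomial.algebraMap_def, MvPolynomial.map_C, map_pow, hd, map_mul, mul_comm, mul_smul]
    exact Submodule.smul_mem _ _ (hwe x)

/-- `ℂ[X₁,…,Xₙ] ⊗ ℂ[T]_{(T)}` as a polynomial ring over `ℂ[T]_{(T)}`. -/
noncomputable def ringEquivRR (n : ℕ) : MvPolynomial (Fin n) Rtwo ≃+* RR n :=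
  ((Algebra.TensorProduct.comm ℂ (MvPolynomial (Fin n) ℂ) Rtwo).toRingEquiv.trans
    (MvPolynomial.algebraTensorAlgEquiv ℂ Rtwo).toRingEquiv).symm

instance isDomain_RR (n : ℕ) : IsDomain (RR n) := (ringEquivRR n).symm.toMulEquiv.isDomain _

instance isNoetherianRing_RR (n : ℕ) : IsNoetherianRing (RR n) :=
  isNoetherianRing_of_ringEquiv _ (ringEquivRR n)

theorem tt_ne_zero (n : ℕ) : tt n ≠ 0 := by
  have h : ringEquivRR n (MvPolynomial.C (algebraMap (Polynomial ℂ) Rtwo Polynomial.X)) = tt n := by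
    refine (RingEquiv.symm_apply_eq _).mpr ?_
    change _ = MvPolynomial.algebraTensorAlgEquiv ℂ Rtwo
      (Algebra.TensorProduct.comm ℂ (MvPolynomial (Fin n) ℂ) Rtwo (1 ⊗ₜ[ℂ] _))
    rw [Algebra.TensorProduct.comm_tmul, MvPolynomial.algebraTensorAlgEquiv_tmul, map_one,
      MvPolynomial.smul_eq_C_mul, mul_one]
  rw [← h, map_ne_zero_iff _ (ringEquivRR n).injective, MvPolynomial.C_ne_zero,
    map_ne_zero_iff _ (IsLocalization.injective Rtwo
      (Ideal.span {(Polynomial.X : Polynomial ℂ)}).primeCompl_le_nonZeroDivisors)]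
  exact Polynomial.X_ne_zero

end PolynomialsOverRtwo

/-- Over the localization of `R = ℂ[X₁,…,Xₙ] ⊗ ℂ[T]_{(T)}` at a maximal ideal `m`
containing `T`, a finitely generated torsion-free module `M` such that `M/TM` is free
and `M[T⁻¹]` is free of the same rank is free; and (Quillen–Suslin) every finitely
generated projective `R`-module is free. -/
theorem stmt_5 (n : ℕ) (r : ℕ) (m : Ideal (RR n)) [m.IsMaximal] (hm : tt n ∈ m)
    (M : Type*) [AddCommGroup M] [Module (Localization.AtPrime m) M]
    [Module.Finite (Localization.AtPrime m) M]
    (htf : ∀ (a : Localization.AtPrime m) (x : M), a • x = 0 → a = 0 ∨ x = 0)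
    (tm : Localization.AtPrime m)
    (htm : tm = algebraMap (RR n) (Localization.AtPrime m) (tt n))
    (h2 : Module.Free ((Localization.AtPrime m) ⧸ Ideal.span {tm})
      (M ⧸ tm • (⊤ : Submodule (Localization.AtPrime m) M)))
    (h2r : Module.rank ((Localization.AtPrime m) ⧸ Ideal.span {tm})
      (M ⧸ tm • (⊤ : Submodule (Localization.AtPrime m) M)) = r)
    (Rt : Type*) [CommRing Rt] [Algebra (Localization.AtPrime m) Rt]
    [IsLocalization (Submonoid.powers tm) Rt]
    (Mt : Type*) [AddCommGroup Mt] [Module (Localization.AtPrime m) Mt] [Module Rt Mt]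
    [IsScalarTower (Localization.AtPrime m) Rt Mt]
    (f : M →ₗ[Localization.AtPrime m] Mt) [IsLocalizedModule (Submonoid.powers tm) f]
    (h1 : Module.Free Rt Mt) (h1r : Module.rank Rt Mt = r) :
    Module.Free (Localization.AtPrime m) M ∧
      ∀ (P : Type) [AddCommGroup P] [Module (RR n) P],
        Module.Finite (RR n) P → Module.Projective (RR n) P → Module.Free (RR n) P := by
  refine ⟨?_, ((projectivesFree_mvPolynomial_Rtwo n).of_ringEquiv (ringEquivRR n))⟩
  have : IsNoetherianRing (Localization.AtPrime m) :=
    IsLocalization.isNoetherianRing m.primeCompl _ inferInstance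
  have : Module.FinitePresentation (Localization.AtPrime m) M :=
    Module.finitePresentation_of_finite _ _
  have htm₀ : tm ≠ 0 := by
    rw [htm, map_ne_zero_iff _ (IsLocalization.injective _ m.primeCompl_le_nonZeroDivisors)]
    exact tt_ne_zero n
  have hreg : IsSMulRegular M tm := fun x y hxy => by
    have := htf tm (x - y) (by rw [smul_sub]; exact sub_eq_zero.mpr hxy)
    exact sub_eq_zero.mp (this.resolve_left htm₀)
  have hjac : tm ∈ (⊥ : Ideal (Localization.AtPrime m)).jacobson := by
    rw [IsLocalRing.jacobson_eq_maximalIdeal _ bot_ne_top, htm]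
    exact (IsLocalization.AtPrime.to_map_mem_maximal_iff (Localization.AtPrime m) m (tt n)).mpr hm
  exact (Module.free_quotSMulTop_iff_free _ M hjac hreg).mp h2
end
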